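/- arXiv:1105.4865 — 4 statements merged into one kernel-verified Lean document; each statement's English description precedes it below -/
import Mathlib

section
/- Monotonicity of quantum relative entropy under pinching: for density matrices ρ, σ on C^n and a family of orthogonal projections {Π_k} summing to the identity, S(ρ‖σ) ≥ S(E(ρ)‖E(σ)) where E(τ) = Σ_k Π_k τ Π_k. -/
open scoped ComplexOrder

/-- The logarithm of a Hermitian matrix, defined via the spectral decomposition
(junk value `0` for non-Hermitian matrices). -/
noncomputable def matrixLog {n : Type*} [Fintype n] [DecidableEq n]
    (A : Matrix n n ℂ) : Matrix n n ℂ :=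
  if hA : A.IsHermitian then
    (Matrix.IsHermitian.eigenvectorUnitary hA : Matrix n n ℂ) *
      Matrix.diagonal (fun i => (Real.log (hA.eigenvalues i) : ℂ)) *
      (star (Matrix.IsHermitian.eigenvectorUnitary hA : Matrix n n ℂ))
  else 0

/-- Quantum relative entropy `S(ρ‖σ) = Tr(ρ log ρ) - Tr(ρ log σ)`. -/
noncomputable def relEnt {n : Type*} [Fintype n] [DecidableEq n]
    (ρ σ : Matrix n n ℂ) : ℝ :=
  ((ρ * matrixLog ρ).trace - (ρ * matrixLog σ).trace).re

section ScalarIntegral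

open MeasureTheory Set Filter Topology

/-- The integrand in the representation of `p log p - p log q + q - p` as an integral over
`t ∈ (0, ∞)`. -/
noncomputable def relEntIntegrand (p q t : ℝ) : ℝ :=
  (p - q) ^ 2 / (q + t * p) * ((1 + t) ^ 2)⁻¹

lemma relEntIntegrand_nonneg {p q t : ℝ} (hp : 0 ≤ p) (hq : 0 ≤ q) (ht : 0 ≤ t) :
    0 ≤ relEntIntegrand p q t := by
  unfold relEntIntegrand; positivity

/-- An antiderivative of `relEntIntegrand p q`. -/
noncomputable def relEntPrimitive (p q t : ℝ) : ℝ :=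
  p * Real.log ((q + t * p) / (1 + t)) - (q - p) * (1 + t)⁻¹

lemma hasDerivAt_relEntPrimitive {p q t : ℝ} (hp : 0 ≤ p) (hq : 0 < q) (ht : 0 ≤ t) :
    HasDerivAt (relEntPrimitive p q) (relEntIntegrand p q t) t := by
  have h1 : 0 < 1 + t := by positivity
  have h2 : 0 < q + t * p := by positivity
  have d1 : HasDerivAt (fun t : ℝ => 1 + t) 1 t := (hasDerivAt_id t).const_add 1
  have d2 : HasDerivAt (fun t : ℝ => q + t * p) (1 * p) t :=
    ((hasDerivAt_id t).mul_const p).const_add q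
  have d := ((((d2.div d1 h1.ne').log (div_pos h2 h1).ne').const_mul p)).sub
    ((d1.inv h1.ne').const_mul (q - p))
  refine d.congr_deriv ?_
  unfold relEntIntegrand
  simp only [Pi.div_apply]
  field_simp
  ring

lemma tendsto_relEntPrimitive {p q : ℝ} (hp : 0 ≤ p) :
    Tendsto (relEntPrimitive p q) atTop (𝓝 (p * Real.log p)) := by
  have hinv : Tendsto (fun t : ℝ => (1 + t)⁻¹) atTop (𝓝 0) :=
    tendsto_inv_atTop_zero.comp (tendsto_atTop_add_const_left _ 1 tendsto_id)
  have hratio : Tendsto (fun t : ℝ => (q + t * p) / (1 + t)) atTop (𝓝 p) := by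
    have h : Tendsto (fun t : ℝ => p + (q - p) * (1 + t)⁻¹) atTop (𝓝 (p + (q - p) * 0)) :=
      (hinv.const_mul _).const_add _
    rw [mul_zero, add_zero] at h
    refine h.congr' ?_
    filter_upwards [eventually_ge_atTop 0] with t ht
    have : 1 + t ≠ 0 := by positivity
    field_simp
    ring
  have hlog : Tendsto (fun t : ℝ => p * Real.log ((q + t * p) / (1 + t))) atTop
      (𝓝 (p * Real.log p)) := by
    rcases hp.eq_or_lt with rfl | hp
    · simp
    · exact (hratio.log hp.ne').const_mul p
  have h := hlog.sub (hinv.const_mul (q - p))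
  rwa [mul_zero, sub_zero] at h

lemma integrableOn_relEntIntegrand {p q : ℝ} (hp : 0 ≤ p) (hq : 0 ≤ q) (h : q = 0 → p = 0) :
    IntegrableOn (relEntIntegrand p q) (Ioi 0) := by
  rcases hq.eq_or_lt with rfl | hq'
  · have : relEntIntegrand p 0 = 0 := by
      funext t; simp [relEntIntegrand, h rfl]
    rw [this]
    exact integrableOn_zero
  · exact integrableOn_Ioi_deriv_of_nonneg'
      (fun t ht => hasDerivAt_relEntPrimitive hp hq' ht)
      (fun t ht => relEntIntegrand_nonneg hp hq (le_of_lt ht)) (tendsto_relEntPrimitive hp)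

lemma integral_relEntIntegrand {p q : ℝ} (hp : 0 ≤ p) (hq : 0 ≤ q) (h : q = 0 → p = 0) :
    ∫ t in Ioi 0, relEntIntegrand p q t = p * Real.log p - p * Real.log q + (q - p) := by
  rcases hq.eq_or_lt with rfl | hq'
  · simp [relEntIntegrand, h rfl]
  · rw [integral_Ioi_of_hasDerivAt_of_nonneg'
      (fun t ht => hasDerivAt_relEntPrimitive hp hq' ht)
      (fun t ht => relEntIntegrand_nonneg hp hq (le_of_lt ht)) (tendsto_relEntPrimitive hp)]
    simp [relEntPrimitive]
    ring

end ScalarIntegral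

section Variational

open Matrix

variable {n : Type*} [Fintype n]

/-- The functional whose supremum over `X` is the integrand of the relative entropy. -/
noncomputable def relEntFunctional (t : ℝ) (ρ σ X : Matrix n n ℂ) : ℝ :=
  (2 * (Xᴴ * (ρ - σ)).trace - (Xᴴ * σ * X).trace - t * (X * ρ * Xᴴ).trace).re

variable [DecidableEq n]

lemma trace_diagonal_re (Y : Matrix n n ℂ) (q : n → ℝ) :
    (Yᴴ * diagonal (fun i => (q i : ℂ)) * Y).trace.re =
      ∑ j, ∑ i, q j * Complex.normSq (Y j i) := by
  rw [Finset.sum_comm]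
  simp only [trace, diag_apply, ↓mul_diagonal, mul_apply, conjTranspose_apply, Complex.re_sum]
  refine Finset.sum_congr rfl fun i _ => Finset.sum_congr rfl fun j _ => ?_
  simp [Complex.normSq_apply]
  ring

lemma trace_diagonal_re' (Y : Matrix n n ℂ) (p : n → ℝ) :
    (Y * diagonal (fun i => (p i : ℂ)) * Yᴴ).trace.re =
      ∑ j, ∑ i, p i * Complex.normSq (Y j i) := by
  simp only [trace, diag_apply, ↓mul_diagonal, mul_apply, conjTranspose_apply, Complex.re_sum]
  refine Finset.sum_congr rfl fun i _ => Finset.sum_congr rfl fun j _ => ?_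
  simp [Complex.normSq_apply]
  ring

/-- The relative entropy functional in eigenbases of its two arguments. -/
lemma relEntFunctional_spectral (t : ℝ) (p q : n → ℝ) {U V : Matrix n n ℂ}
    (hU : Uᴴ * U = 1) (hV : Vᴴ * V = 1) (Y : Matrix n n ℂ) :
    relEntFunctional t (U * diagonal (fun i => (p i : ℂ)) * Uᴴ)
      (V * diagonal (fun i => (q i : ℂ)) * Vᴴ) (V * Y * Uᴴ) =
    ∑ j, ∑ i, (2 * (p i - q j) * (star (Y j i) * (Vᴴ * U) j i).re
      - (q j + t * p i) * Complex.normSq (Y j i)) := by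
  set P : Matrix n n ℂ := diagonal (fun i => (p i : ℂ))
  set Q : Matrix n n ℂ := diagonal (fun i => (q i : ℂ))
  have e1 : ((V * Y * Uᴴ)ᴴ * (U * P * Uᴴ - V * Q * Vᴴ)).trace =
      (Yᴴ * (Vᴴ * U * P - Q * (Vᴴ * U))).trace := by
    have h : (V * Y * Uᴴ)ᴴ * (U * P * Uᴴ - V * Q * Vᴴ) =
        U * (Yᴴ * (Vᴴ * U * P * Uᴴ - (Vᴴ * V) * Q * Vᴴ)) := by
      simp only [conjTranspose_mul, conjTranspose_conjTranspose, mul_sub, Matrix.mul_assoc]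
    rw [h, hV, trace_mul_comm]
    have h' : Yᴴ * (Vᴴ * U * P * Uᴴ - 1 * Q * Vᴴ) * U =
        Yᴴ * (Vᴴ * U * P * (Uᴴ * U) - Q * (Vᴴ * U)) := by
      simp only [mul_sub, sub_mul, Matrix.mul_assoc, one_mul]
    rw [h', hU, mul_one]
  have e2 : ((V * Y * Uᴴ)ᴴ * (V * Q * Vᴴ) * (V * Y * Uᴴ)).trace = (Yᴴ * Q * Y).trace := by
    have h : (V * Y * Uᴴ)ᴴ * (V * Q * Vᴴ) * (V * Y * Uᴴ) =
        U * (Yᴴ * (Vᴴ * V) * Q * (Vᴴ * V) * Y * Uᴴ) := by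
      simp only [conjTranspose_mul, conjTranspose_conjTranspose, Matrix.mul_assoc]
    rw [h, hV, trace_mul_comm, Matrix.mul_assoc _ Uᴴ U, hU]
    simp only [mul_one]
  have e3 : (V * Y * Uᴴ * (U * P * Uᴴ) * (V * Y * Uᴴ)ᴴ).trace = (Y * P * Yᴴ).trace := by
    have h : V * Y * Uᴴ * (U * P * Uᴴ) * (V * Y * Uᴴ)ᴴ =
        V * (Y * (Uᴴ * U) * P * (Uᴴ * U) * Yᴴ * Vᴴ) := by
      simp only [conjTranspose_mul, conjTranspose_conjTranspose, Matrix.mul_assoc]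
    rw [h, hU, trace_mul_comm, Matrix.mul_assoc _ Vᴴ V, hV]
    simp only [mul_one]
  have e4 : (Yᴴ * (Vᴴ * U * P - Q * (Vᴴ * U))).trace.re =
      ∑ j, ∑ i, (p i - q j) * (star (Y j i) * (Vᴴ * U) j i).re := by
    generalize Vᴴ * U = W
    rw [Finset.sum_comm]
    simp only [trace, diag_apply, mul_apply (M := Yᴴ), conjTranspose_apply, Complex.re_sum,
      Matrix.sub_apply, P, Q, mul_diagonal, diagonal_mul]
    refine Finset.sum_congr rfl fun i _ => Finset.sum_congr rfl fun j _ => ?_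
    simp
    ring
  unfold relEntFunctional
  rw [e1, e2, e3]
  simp only [Complex.sub_re, Complex.re_ofReal_mul, trace_diagonal_re, trace_diagonal_re', P, Q,
    Complex.mul_re (2 : ℂ), Complex.re_ofNat, Complex.im_ofNat, zero_mul, sub_zero] at e4 ⊢
  rw [e4]
  simp only [Finset.mul_sum, ← Finset.sum_sub_distrib]
  refine Finset.sum_congr rfl fun i _ => Finset.sum_congr rfl fun j _ => ?_
  ring

/-- The supremum of the relative entropy functional, in eigenbases. -/
noncomputable def relEntKernel (t : ℝ) (p q : n → ℝ) (W : Matrix n n ℂ) : ℝ :=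
  ∑ j, ∑ i, Complex.normSq (W j i) * ((p i - q j) ^ 2 / (q j + t * p i))

lemma relEntFunctional_le_kernel {t : ℝ} (ht : 0 < t) {p q : n → ℝ} (hp : 0 ≤ p) (hq : 0 ≤ q)
    {U V : Matrix n n ℂ} (hU : Uᴴ * U = 1) (hV : Vᴴ * V = 1) (X : Matrix n n ℂ) :
    relEntFunctional t (U * diagonal (fun i => (p i : ℂ)) * Uᴴ)
      (V * diagonal (fun i => (q i : ℂ)) * Vᴴ) X ≤ relEntKernel t p q (Vᴴ * U) := by
  have hX : X = V * (Vᴴ * X * U) * Uᴴ := by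
    have : V * (Vᴴ * X * U) * Uᴴ = (V * Vᴴ) * X * (U * Uᴴ) := by
      simp only [Matrix.mul_assoc]
    rw [this, mul_eq_one_comm.mp hU, mul_eq_one_comm.mp hV, one_mul, mul_one]
  rw [hX, relEntFunctional_spectral t p q hU hV]
  generalize Vᴴ * X * U = Y
  unfold relEntKernel
  refine Finset.sum_le_sum fun j _ => Finset.sum_le_sum fun i _ => ?_
  generalize (Vᴴ * U) j i = w
  have hp' : 0 ≤ p i := hp i
  have hq' : 0 ≤ q j := hq j
  rcases (add_nonneg hq' (mul_nonneg ht.le hp')).eq_or_lt with h | h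
  · have h1 : q j = 0 := by nlinarith [mul_nonneg ht.le hp']
    have h2 : p i = 0 := by
      rw [h1, zero_add] at h
      exact (mul_eq_zero.mp h.symm).resolve_left ht.ne'
    simp [h1, h2]
  · rw [← mul_div_assoc, le_div_iff₀ h]
    simp only [Complex.normSq_apply, Complex.star_def, Complex.mul_re, Complex.conj_re,
      Complex.conj_im]
    nlinarith [sq_nonneg ((p i - q j) * w.re - (q j + t * p i) * (Y j i).re),
      sq_nonneg ((p i - q j) * w.im - (q j + t * p i) * (Y j i).im)]

lemma exists_relEntFunctional_eq_kernel {t : ℝ} (ht : 0 < t) {p q : n → ℝ}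
    (hp : 0 ≤ p) (hq : 0 ≤ q)
    {U V : Matrix n n ℂ} (hU : Uᴴ * U = 1) (hV : Vᴴ * V = 1) :
    ∃ X, relEntFunctional t (U * diagonal (fun i => (p i : ℂ)) * Uᴴ)
      (V * diagonal (fun i => (q i : ℂ)) * Vᴴ) X = relEntKernel t p q (Vᴴ * U) := by
  refine ⟨V * (Matrix.of fun j i =>
    (((p i - q j) / (q j + t * p i) : ℝ) : ℂ) * (Vᴴ * U) j i) * Uᴴ, ?_⟩
  rw [relEntFunctional_spectral t p q hU hV]
  unfold relEntKernel
  refine Finset.sum_congr rfl fun j _ => Finset.sum_congr rfl fun i _ => ?_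
  rw [Matrix.of_apply]
  generalize (Vᴴ * U) j i = w
  have hp' : 0 ≤ p i := hp i
  have hq' : 0 ≤ q j := hq j
  rcases (add_nonneg hq' (mul_nonneg ht.le hp')).eq_or_lt with h | h
  · simp [← h]
  · simp only [Complex.star_def, map_mul, Complex.conj_ofReal, mul_assoc, Complex.re_ofReal_mul,
      ← Complex.normSq_eq_conj_mul_self, Complex.ofReal_re, Complex.normSq_ofReal]
    field_simp
    ring

end Variational

section Pinching

open Matrix

variable {n : Type*} [Fintype n] {K : Type*} [Fintype K]

/-- The pinching map `τ ↦ ∑ k, Pr k * τ * Pr k`. -/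
noncomputable def pinching (Pr : K → Matrix n n ℂ) (τ : Matrix n n ℂ) : Matrix n n ℂ :=
  ∑ k, Pr k * τ * Pr k

lemma pinching_sub (Pr : K → Matrix n n ℂ) (ρ σ : Matrix n n ℂ) :
    pinching Pr (ρ - σ) = pinching Pr ρ - pinching Pr σ := by
  simp [pinching, mul_sub, sub_mul]

lemma trace_mul_pinching (Pr : K → Matrix n n ℂ) (A τ : Matrix n n ℂ) :
    (A * pinching Pr τ).trace = (pinching Pr A * τ).trace := by
  simp only [pinching, Finset.mul_sum, Finset.sum_mul, trace_sum]
  refine Finset.sum_congr rfl fun k _ => ?_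
  rw [← Matrix.mul_assoc, trace_mul_comm]
  simp only [Matrix.mul_assoc]

lemma conjTranspose_pinching {Pr : K → Matrix n n ℂ} (hherm : ∀ k, (Pr k).IsHermitian)
    (τ : Matrix n n ℂ) : (pinching Pr τ)ᴴ = pinching Pr τᴴ := by
  simp only [pinching, conjTranspose_sum, conjTranspose_mul, (hherm _).eq, Matrix.mul_assoc]

lemma posSemidef_pinching {Pr : K → Matrix n n ℂ} (hherm : ∀ k, (Pr k).IsHermitian)
    {τ : Matrix n n ℂ} (hτ : τ.PosSemidef) : (pinching Pr τ).PosSemidef := by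
  refine Matrix.posSemidef_sum _ fun k _ => ?_
  have := hτ.conjTranspose_mul_mul_same (Pr k)
  rwa [(hherm k).eq] at this

lemma trace_pinching [DecidableEq n] {Pr : K → Matrix n n ℂ} (hidem : ∀ k, Pr k * Pr k = Pr k)
    (hsum : ∑ k, Pr k = 1) (τ : Matrix n n ℂ) : (pinching Pr τ).trace = τ.trace := by
  have h : pinching Pr 1 = 1 := by simp [pinching, hidem, hsum]
  have := trace_mul_pinching Pr 1 τ
  rwa [h, one_mul, one_mul] at this

/-- Pinching `X` does not increase `Tr (Xᴴ τ X)` when compared with pinching `τ`. -/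
lemma trace_conj_pinching_le [DecidableEq n] {Pr : K → Matrix n n ℂ}
    (hherm : ∀ k, (Pr k).IsHermitian) (hidem : ∀ k, Pr k * Pr k = Pr k)
    (horth : ∀ k k', k ≠ k' → Pr k * Pr k' = 0) (hsum : ∑ k, Pr k = 1)
    {τ : Matrix n n ℂ} (hτ : τ.PosSemidef) (X : Matrix n n ℂ) :
    ((pinching Pr X)ᴴ * τ * pinching Pr X).trace.re ≤ (Xᴴ * pinching Pr τ * X).trace.re := by
  have hnonneg : ∀ k l, 0 ≤ (Pr l * (Xᴴ * Pr k * τ * Pr k * X) * Pr l).trace.re := by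
    intro k l
    have h := (hτ.conjTranspose_mul_mul_same (Pr k * X * Pr l)).trace_nonneg
    have e : (Pr k * X * Pr l)ᴴ * τ * (Pr k * X * Pr l) =
        Pr l * (Xᴴ * Pr k * τ * Pr k * X) * Pr l := by
      simp only [conjTranspose_mul, (hherm _).eq, Matrix.mul_assoc]
    rw [e] at h
    exact (Complex.le_def.mp h).1
  have hR : (Xᴴ * pinching Pr τ * X).trace.re =
      ∑ k, ∑ l, (Pr l * (Xᴴ * Pr k * τ * Pr k * X) * Pr l).trace.re := by
    have : Xᴴ * pinching Pr τ * X = ∑ k, Xᴴ * Pr k * τ * Pr k * X := by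
      simp only [pinching, Finset.mul_sum, Finset.sum_mul, Matrix.mul_assoc]
    rw [this, trace_sum, Complex.re_sum]
    refine Finset.sum_congr rfl fun k _ => ?_
    rw [← trace_pinching hidem hsum, pinching, trace_sum, Complex.re_sum]
  have hL : ((pinching Pr X)ᴴ * τ * pinching Pr X).trace.re =
      ∑ k, (Pr k * (Xᴴ * Pr k * τ * Pr k * X) * Pr k).trace.re := by
    rw [conjTranspose_pinching hherm]
    have : pinching Pr Xᴴ * τ * pinching Pr X =
        ∑ k, ∑ l, Pr k * (Xᴴ * Pr k * τ * Pr l * X * Pr l) := by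
      simp only [pinching, Finset.mul_sum, Finset.sum_mul, Matrix.mul_assoc]
      rw [Finset.sum_comm]
    rw [this, trace_sum, Complex.re_sum]
    refine Finset.sum_congr rfl fun k _ => ?_
    rw [trace_sum, Finset.sum_eq_single k]
    · simp only [Matrix.mul_assoc]
    · intro l _ hl
      rw [trace_mul_comm, Matrix.mul_assoc, horth l k hl, mul_zero, trace_zero]
    · simp
  rw [hL, hR]
  exact Finset.sum_le_sum fun k _ =>
    Finset.single_le_sum (f := fun l => (Pr l * (Xᴴ * Pr k * τ * Pr k * X) * Pr l).trace.re)
      (fun l _ => hnonneg k l) (Finset.mem_univ k)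

lemma relEntFunctional_pinching_le [DecidableEq n] {Pr : K → Matrix n n ℂ}
    (hherm : ∀ k, (Pr k).IsHermitian) (hidem : ∀ k, Pr k * Pr k = Pr k)
    (horth : ∀ k k', k ≠ k' → Pr k * Pr k' = 0) (hsum : ∑ k, Pr k = 1)
    {ρ σ : Matrix n n ℂ} (hρ : ρ.PosSemidef) (hσ : σ.PosSemidef) {t : ℝ} (ht : 0 ≤ t)
    (X : Matrix n n ℂ) :
    relEntFunctional t (pinching Pr ρ) (pinching Pr σ) X ≤
      relEntFunctional t ρ σ (pinching Pr X) := by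
  have h1 := trace_conj_pinching_le hherm hidem horth hsum hσ X
  have h2 := trace_conj_pinching_le hherm hidem horth hsum hρ Xᴴ
  rw [conjTranspose_pinching hherm, conjTranspose_conjTranspose] at h2
  unfold relEntFunctional
  rw [← pinching_sub, trace_mul_pinching]
  rw [conjTranspose_pinching hherm] at h1 ⊢
  simp only [Complex.sub_re, Complex.re_ofReal_mul]
  have := mul_le_mul_of_nonneg_left h2 ht
  linarith

lemma pinching_mulVec_eq_zero {Pr : K → Matrix n n ℂ}
    (hherm : ∀ k, (Pr k).IsHermitian) {ρ σ : Matrix n n ℂ} (hσ : σ.PosSemidef)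
    (hsupp : ∀ x : n → ℂ, σ *ᵥ x = 0 → ρ *ᵥ x = 0) (x : n → ℂ)
    (hx : pinching Pr σ *ᵥ x = 0) : pinching Pr ρ *ᵥ x = 0 := by
  have hform : ∀ k, star x ⬝ᵥ ((Pr k * σ * Pr k) *ᵥ x) =
      star (Pr k *ᵥ x) ⬝ᵥ (σ *ᵥ (Pr k *ᵥ x)) := by
    intro k
    rw [star_mulVec, (hherm k).eq, ← dotProduct_mulVec]
    simp only [mulVec_mulVec, Matrix.mul_assoc]
  have hzero : ∑ k, star (Pr k *ᵥ x) ⬝ᵥ (σ *ᵥ (Pr k *ᵥ x)) = 0 := by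
    rw [← Finset.sum_congr rfl fun k _ => hform k, ← dotProduct_sum, ← sum_mulVec]
    change star x ⬝ᵥ (pinching Pr σ *ᵥ x) = 0
    rw [hx, dotProduct_zero]
  have hk := (Finset.sum_eq_zero_iff_of_nonneg fun k _ =>
    hσ.dotProduct_mulVec_nonneg (Pr k *ᵥ x)).mp hzero
  unfold pinching
  rw [sum_mulVec]
  refine Finset.sum_eq_zero fun k _ => ?_
  have := hsupp _ ((hσ.dotProduct_mulVec_zero_iff _).mp (hk k (Finset.mem_univ k)))
  rw [Matrix.mul_assoc, ← mulVec_mulVec, ← mulVec_mulVec, this, mulVec_zero]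

end Pinching

section Spectral

open Matrix MeasureTheory Set

variable {n : Type*} [Fintype n] [DecidableEq n]

/-- The overlap matrix between the eigenbases of `ρ` and `σ`. -/
noncomputable def eigenOverlap {ρ σ : Matrix n n ℂ} (hρ : ρ.IsHermitian) (hσ : σ.IsHermitian) :
    Matrix n n ℂ :=
  (hσ.eigenvectorUnitary : Matrix n n ℂ)ᴴ * (hρ.eigenvectorUnitary : Matrix n n ℂ)

lemma eigenvectorUnitary_conjTranspose_mul_self {A : Matrix n n ℂ} (hA : A.IsHermitian) :
    (hA.eigenvectorUnitary : Matrix n n ℂ)ᴴ * (hA.eigenvectorUnitary : Matrix n n ℂ) = 1 :=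
  Unitary.coe_star_mul_self _

lemma eq_eigenvectorUnitary_mul_diagonal {A : Matrix n n ℂ} (hA : A.IsHermitian) :
    A = (hA.eigenvectorUnitary : Matrix n n ℂ) * diagonal (fun i => (hA.eigenvalues i : ℂ)) *
      (hA.eigenvectorUnitary : Matrix n n ℂ)ᴴ :=
  hA.spectral_theorem

lemma sum_normSq_row {W : Matrix n n ℂ} (hW : Wᴴ * W = 1) (j : n) :
    ∑ i, Complex.normSq (W j i) = 1 := by
  have hW' : W * Wᴴ = 1 := mul_eq_one_comm.mp hW
  have h := congrFun (congrFun hW' j) j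
  rw [mul_apply, one_apply_eq] at h
  simp only [conjTranspose_apply, Complex.star_def, Complex.mul_conj] at h
  exact_mod_cast h

lemma sum_normSq_col {W : Matrix n n ℂ} (hW : Wᴴ * W = 1) (i : n) :
    ∑ j, Complex.normSq (W j i) = 1 := by
  have h := congrFun (congrFun hW i) i
  rw [mul_apply, one_apply_eq] at h
  simp only [conjTranspose_apply, Complex.star_def, ← Complex.normSq_eq_conj_mul_self] at h
  exact_mod_cast h

lemma eigenOverlap_unitary {ρ σ : Matrix n n ℂ} (hρ : ρ.IsHermitian) (hσ : σ.IsHermitian) :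
    (eigenOverlap hρ hσ)ᴴ * eigenOverlap hρ hσ = 1 := by
  have hV := mul_eq_one_comm.mp (eigenvectorUnitary_conjTranspose_mul_self hσ)
  unfold eigenOverlap
  rw [conjTranspose_mul, conjTranspose_conjTranspose, Matrix.mul_assoc, ← Matrix.mul_assoc _ _
    (hρ.eigenvectorUnitary : Matrix n n ℂ), hV, one_mul,
    eigenvectorUnitary_conjTranspose_mul_self]

lemma trace_mul_spectral_re {ρ σ : Matrix n n ℂ} (hρ : ρ.IsHermitian) (hσ : σ.IsHermitian)
    (g : n → ℝ) :
    (ρ * ((hσ.eigenvectorUnitary : Matrix n n ℂ) * diagonal (fun i => (g i : ℂ)) *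
      (hσ.eigenvectorUnitary : Matrix n n ℂ)ᴴ)).trace.re =
    ∑ j, ∑ i, Complex.normSq (eigenOverlap hρ hσ j i) * (hρ.eigenvalues i * g j) := by
  set U := (hρ.eigenvectorUnitary : Matrix n n ℂ) with hU
  set V := (hσ.eigenvectorUnitary : Matrix n n ℂ) with hV
  have h1 : (ρ * (V * diagonal (fun i => (g i : ℂ)) * Vᴴ)).trace =
      (eigenOverlap hρ hσ * diagonal (fun i => (hρ.eigenvalues i : ℂ)) * (eigenOverlap hρ hσ)ᴴ *
        diagonal (fun i => (g i : ℂ))).trace := by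
    conv_lhs => rw [eq_eigenvectorUnitary_mul_diagonal hρ]
    rw [← Matrix.mul_assoc, trace_mul_comm]
    simp only [eigenOverlap, conjTranspose_mul, conjTranspose_conjTranspose, Matrix.mul_assoc,
      ← hU, ← hV]
  rw [h1]
  generalize eigenOverlap hρ hσ = W
  simp only [trace, diag_apply, ↓mul_diagonal, mul_apply, conjTranspose_apply, Complex.re_sum,
    Finset.sum_mul]
  refine Finset.sum_congr rfl fun i _ => Finset.sum_congr rfl fun j _ => ?_
  simp [Complex.normSq_apply]
  ring

lemma trace_re_eq_sum_eigenvalues {A : Matrix n n ℂ} (hA : A.IsHermitian) :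
    A.trace.re = ∑ i, hA.eigenvalues i := by
  rw [hA.trace_eq_sum_eigenvalues]
  simp

lemma trace_mul_matrixLog_self_re {ρ : Matrix n n ℂ} (hρ : ρ.IsHermitian) :
    (ρ * matrixLog ρ).trace.re = ∑ i, hρ.eigenvalues i * Real.log (hρ.eigenvalues i) := by
  rw [matrixLog, dif_pos hρ]
  refine (trace_mul_spectral_re hρ hρ _).trans ?_
  have : eigenOverlap hρ hρ = 1 := eigenvectorUnitary_conjTranspose_mul_self hρ
  simp [this, one_apply, apply_ite]

lemma relEnt_eq_sum {ρ σ : Matrix n n ℂ} (hρ : ρ.IsHermitian) (hσ : σ.IsHermitian)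
    (htr : ρ.trace = σ.trace) :
    relEnt ρ σ = ∑ j, ∑ i, Complex.normSq (eigenOverlap hρ hσ j i) *
      (hρ.eigenvalues i * Real.log (hρ.eigenvalues i) -
        hρ.eigenvalues i * Real.log (hσ.eigenvalues j) +
          (hσ.eigenvalues j - hρ.eigenvalues i)) := by
  have hcol : ∀ f : n → ℝ,
      ∑ j, ∑ i, Complex.normSq (eigenOverlap hρ hσ j i) * f i = ∑ i, f i := by
    intro f
    rw [Finset.sum_comm]
    simp only [← Finset.sum_mul, sum_normSq_col (eigenOverlap_unitary hρ hσ), one_mul]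
  have hrow : ∀ f : n → ℝ,
      ∑ j, ∑ i, Complex.normSq (eigenOverlap hρ hσ j i) * f j = ∑ j, f j := by
    intro f
    simp only [← Finset.sum_mul, sum_normSq_row (eigenOverlap_unitary hρ hσ), one_mul]
  have hlogσ := trace_mul_spectral_re hρ hσ (fun j => Real.log (hσ.eigenvalues j))
  have htr' := congrArg Complex.re htr
  rw [trace_re_eq_sum_eigenvalues hρ, trace_re_eq_sum_eigenvalues hσ] at htr'
  unfold relEnt
  rw [Complex.sub_re, trace_mul_matrixLog_self_re hρ]
  conv_lhs => rw [matrixLog, dif_pos hσ]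
  simp only [mul_add, mul_sub, Finset.sum_add_distrib, Finset.sum_sub_distrib, hcol, hrow]
  rw [← hlogσ, htr', sub_self, add_zero]
  rfl

lemma eigenOverlap_eq_zero_of_support {ρ σ : Matrix n n ℂ} (hρ : ρ.IsHermitian)
    (hσ : σ.IsHermitian) (hsupp : ∀ x : n → ℂ, σ *ᵥ x = 0 → ρ *ᵥ x = 0) {i j : n}
    (hj : hσ.eigenvalues j = 0) (hi : hρ.eigenvalues i ≠ 0) : eigenOverlap hρ hσ j i = 0 := by
  have h1 : σ *ᵥ ⇑(hσ.eigenvectorBasis j) = 0 := by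
    rw [hσ.mulVec_eigenvectorBasis, hj, zero_smul]
  have h2 := hsupp _ h1
  have h3 : (hρ.eigenvalues i : ℂ) * (eigenOverlap hρ hσ)ᴴ i j = 0 := by
    set U := (hρ.eigenvectorUnitary : Matrix n n ℂ) with hU
    rw [← hσ.eigenvectorUnitary_mulVec] at h2
    rw [eq_eigenvectorUnitary_mul_diagonal hρ] at h2
    have h4 := congrArg (fun v => (Uᴴ *ᵥ v) i) h2
    simp only [mulVec_mulVec, mulVec_zero, Pi.zero_apply, ← Matrix.mul_assoc, ← hU] at h4
    rw [hU, eigenvectorUnitary_conjTranspose_mul_self, one_mul, Matrix.mul_assoc,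
      mulVec_single_one, col_apply, diagonal_mul] at h4
    rw [← h4, eigenOverlap, conjTranspose_mul, conjTranspose_conjTranspose]
  have h5 := (mul_eq_zero.mp h3).resolve_left (by exact_mod_cast hi)
  simpa using h5

lemma integrableOn_and_relEnt_eq_integral {ρ σ : Matrix n n ℂ} (hρ : ρ.PosSemidef)
    (hσ : σ.PosSemidef) (htr : ρ.trace = σ.trace)
    (hsupp : ∀ x : n → ℂ, σ *ᵥ x = 0 → ρ *ᵥ x = 0) :
    IntegrableOn (fun t => relEntKernel t hρ.1.eigenvalues hσ.1.eigenvalues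
      (eigenOverlap hρ.1 hσ.1) * ((1 + t) ^ 2)⁻¹) (Ioi 0) ∧
    relEnt ρ σ = ∫ t in Ioi 0, relEntKernel t hρ.1.eigenvalues hσ.1.eigenvalues
      (eigenOverlap hρ.1 hσ.1) * ((1 + t) ^ 2)⁻¹ := by
  have hfun : (fun t => relEntKernel t hρ.1.eigenvalues hσ.1.eigenvalues
      (eigenOverlap hρ.1 hσ.1) * ((1 + t) ^ 2)⁻¹) = fun t => ∑ j, ∑ i,
      Complex.normSq (eigenOverlap hρ.1 hσ.1 j i) *
        relEntIntegrand (hρ.1.eigenvalues i) (hσ.1.eigenvalues j) t := by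
    funext t
    simp only [relEntKernel, relEntIntegrand, Finset.sum_mul, mul_assoc]
  have hzero : ∀ i j, eigenOverlap hρ.1 hσ.1 j i = 0 ∨
      (hσ.1.eigenvalues j = 0 → hρ.1.eigenvalues i = 0) := by
    intro i j
    by_contra! h
    exact h.1 (eigenOverlap_eq_zero_of_support hρ.1 hσ.1 hsupp h.2.1 h.2.2)
  have hint : ∀ j i, IntegrableOn (fun t => Complex.normSq (eigenOverlap hρ.1 hσ.1 j i) *
      relEntIntegrand (hρ.1.eigenvalues i) (hσ.1.eigenvalues j) t) (Ioi 0) := by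
    intro j i
    rcases hzero i j with h | h
    · simp [h]
    · exact (integrableOn_relEntIntegrand (hρ.eigenvalues_nonneg i)
        (hσ.eigenvalues_nonneg j) h).const_mul _
  rw [hfun]
  refine ⟨integrable_finsetSum _ fun j _ => integrable_finsetSum _ fun i _ => hint j i, ?_⟩
  rw [relEnt_eq_sum hρ.1 hσ.1 htr,
    integral_finsetSum _ fun j _ => integrable_finsetSum _ fun i _ => hint j i]
  refine Finset.sum_congr rfl fun j _ => ?_
  rw [integral_finsetSum _ fun i _ => hint j i]
  refine Finset.sum_congr rfl fun i _ => ?_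
  rw [integral_const_mul]
  rcases hzero i j with h | h
  · simp [h]
  · rw [integral_relEntIntegrand (hρ.eigenvalues_nonneg i) (hσ.eigenvalues_nonneg j) h]

end Spectral

/-- Monotonicity of quantum relative entropy under pinching:
for density matrices `ρ, σ` (with `supp ρ ⊆ supp σ`) and a family of mutually
orthogonal projections `{Pr k}` summing to the identity,
`S(ρ‖σ) ≥ S(E(ρ)‖E(σ))` where `E(τ) = ∑ k, Pr k * τ * Pr k`. -/
theorem relEnt_pinching_mono {n : Type*} [Fintype n] [DecidableEq n]
    {K : Type*} [Fintype K]
    (ρ σ : Matrix n n ℂ) (hρ : ρ.PosSemidef) (hσ : σ.PosSemidef)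
    (hρ1 : ρ.trace = 1) (hσ1 : σ.trace = 1)
    (hsupp : ∀ x : n → ℂ, σ.mulVec x = 0 → ρ.mulVec x = 0)
    (Pr : K → Matrix n n ℂ)
    (hherm : ∀ k, (Pr k).IsHermitian) (hidem : ∀ k, Pr k * Pr k = Pr k)
    (horth : ∀ k k', k ≠ k' → Pr k * Pr k' = 0) (hsum : ∑ k, Pr k = 1) :
    relEnt ρ σ ≥ relEnt (∑ k, Pr k * ρ * Pr k) (∑ k, Pr k * σ * Pr k) := by
  have htr : ρ.trace = σ.trace := hρ1.trans hσ1.symm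
  have hEρ : (pinching Pr ρ).PosSemidef := posSemidef_pinching hherm hρ
  have hEσ : (pinching Pr σ).PosSemidef := posSemidef_pinching hherm hσ
  have hEtr : (pinching Pr ρ).trace = (pinching Pr σ).trace := by
    rw [trace_pinching hidem hsum, trace_pinching hidem hsum, htr]
  obtain ⟨hint, heq⟩ := integrableOn_and_relEnt_eq_integral hρ hσ htr hsupp
  obtain ⟨hEint, hEeq⟩ := integrableOn_and_relEnt_eq_integral hEρ hEσ hEtr
    (pinching_mulVec_eq_zero hherm hσ hsupp)
  change relEnt (pinching Pr ρ) (pinching Pr σ) ≤ relEnt ρ σ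
  rw [heq, hEeq]
  refine MeasureTheory.setIntegral_mono_on hEint hint measurableSet_Ioi fun t ht => ?_
  refine mul_le_mul_of_nonneg_right ?_ (by positivity)
  obtain ⟨X, hX⟩ := exists_relEntFunctional_eq_kernel (Set.mem_Ioi.mp ht)
    (fun i => hEρ.eigenvalues_nonneg i) (fun i => hEσ.eigenvalues_nonneg i)
    (eigenvectorUnitary_conjTranspose_mul_self hEρ.1)
    (eigenvectorUnitary_conjTranspose_mul_self hEσ.1)
  rw [← eq_eigenvectorUnitary_mul_diagonal, ← eq_eigenvectorUnitary_mul_diagonal] at hX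
  have hle := relEntFunctional_le_kernel (Set.mem_Ioi.mp ht)
    (fun i => hρ.eigenvalues_nonneg i) (fun i => hσ.eigenvalues_nonneg i)
    (eigenvectorUnitary_conjTranspose_mul_self hρ.1)
    (eigenvectorUnitary_conjTranspose_mul_self hσ.1) (pinching Pr X)
  rw [← eq_eigenvectorUnitary_mul_diagonal, ← eq_eigenvectorUnitary_mul_diagonal] at hle
  exact hX.symm.le.trans ((relEntFunctional_pinching_le hherm hidem horth hsum hρ hσ
    (le_of_lt ht) X).trans hle)
end

section
/- Antimonotonicity of relative entropy in the second argument: if ρ is a density matrix and σ, τ are positive semidefinite matrices with σ ≤ τ (in the Loewner order) and supp ρ ⊆ supp σ, then S(ρ‖σ) ≥ S(ρ‖τ). -/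
open scoped ComplexOrder

section

open scoped MatrixOrder Matrix.Norms.L2Operator Topology
open Filter

theorem Matrix.PosSemidef.mulVec_eq_zero_of_le {n : Type*} [Fintype n] {A B : Matrix n n ℂ}
    (hA : A.PosSemidef) (hAB : A ≤ B) {x : n → ℂ} (hx : B.mulVec x = 0) : A.mulVec x = 0 := by
  rw [← hA.dotProduct_mulVec_zero_iff]
  have h := Matrix.PosSemidef.dotProduct_mulVec_nonneg hAB x
  rw [Matrix.sub_mulVec, hx, zero_sub, dotProduct_neg, neg_nonneg] at h
  exact le_antisymm h (hA.dotProduct_mulVec_nonneg x)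

variable {n : Type*} [Fintype n] [DecidableEq n]

theorem matrixLog_eq_cfc {A : Matrix n n ℂ} (hA : A.IsHermitian) :
    matrixLog A = cfc Real.log A := by
  rw [hA.cfc_eq, matrixLog, dif_pos hA, Matrix.IsHermitian.cfc, Unitary.conjStarAlgAut_apply]
  rfl

theorem trace_mul_cfc {A : Matrix n n ℂ} (hA : A.IsHermitian) (ρ : Matrix n n ℂ) (f : ℝ → ℝ) :
    (ρ * cfc f A).trace = ∑ i, (star (hA.eigenvectorUnitary : Matrix n n ℂ) * ρ *
      (hA.eigenvectorUnitary : Matrix n n ℂ)) i i * (f (hA.eigenvalues i) : ℂ) := by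
  rw [hA.cfc_eq, Matrix.IsHermitian.cfc, Unitary.conjStarAlgAut_apply, ← mul_assoc,
    Matrix.trace_mul_comm, ← mul_assoc, ← mul_assoc]
  simp [Matrix.trace, Matrix.mul_diagonal]

theorem eigenvectorUnitary_conj_apply_eq_zero {A ρ : Matrix n n ℂ} (hA : A.IsHermitian)
    (hker : ∀ x : n → ℂ, A.mulVec x = 0 → ρ.mulVec x = 0) {i : n} (hi : hA.eigenvalues i = 0) :
    (star (hA.eigenvectorUnitary : Matrix n n ℂ) * ρ *
      (hA.eigenvectorUnitary : Matrix n n ℂ)) i i = 0 := by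
  have h := hker _ (by rw [hA.mulVec_eigenvectorBasis i, hi, zero_smul])
  rw [mul_assoc, Matrix.mul_apply]
  refine Finset.sum_eq_zero fun j _ => ?_
  have hj : (ρ * (hA.eigenvectorUnitary : Matrix n n ℂ)) j i = 0 := by
    simpa [Matrix.mul_apply, Matrix.mulVec, dotProduct] using congrFun h j
  rw [hj, mul_zero]

/-- If `ker A ⊆ ker ρ`, the trace of `ρ log (A + ε)` converges to that of `ρ log A`, where the
logarithm of `A` is taken on its support. -/
theorem tendsto_trace_mul_log_add {A ρ : Matrix n n ℂ} (hA : A.IsHermitian)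
    (hker : ∀ x : n → ℂ, A.mulVec x = 0 → ρ.mulVec x = 0) :
    Tendsto (fun ε : ℝ => (ρ * cfc (fun x => Real.log (x + ε)) A).trace) (𝓝[>] 0)
      (𝓝 (ρ * cfc Real.log A).trace) := by
  simp only [trace_mul_cfc hA]
  refine tendsto_finsetSum _ fun i _ => ?_
  by_cases hi : hA.eigenvalues i = 0
  · simp [eigenvectorUnitary_conj_apply_eq_zero hA hker hi]
  · refine Tendsto.const_mul _ ((Complex.continuous_ofReal.tendsto _).comp ?_)
    have h : Tendsto (fun ε : ℝ => Real.log (hA.eigenvalues i + ε)) (𝓝 0)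
        (𝓝 (Real.log (hA.eigenvalues i + 0))) :=
      ((continuous_const.add continuous_id).tendsto 0).log (by simpa using hi)
    simpa using h.mono_left nhdsWithin_le_nhds

theorem log_add_algebraMap {A : Matrix n n ℂ} (hA : A.PosSemidef) {ε : ℝ} (hε : 0 < ε) :
    CFC.log (A + algebraMap ℝ (Matrix n n ℂ) ε) = cfc (fun x => Real.log (x + ε)) A := by
  have hpos : ∀ x ∈ spectrum ℝ A, 0 ≤ x := fun x hx => spectrum_nonneg_of_nonneg hA.nonneg hx
  have hsa : IsSelfAdjoint A := hA.1
  have hlog : ContinuousOn Real.log ((fun x => x + ε) '' spectrum ℝ A) := by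
    refine Real.continuousOn_log.mono ?_
    rintro _ ⟨x, hx, rfl⟩
    exact (add_pos_of_nonneg_of_pos (hpos x hx) hε).ne'
  rw [cfc_comp' Real.log (fun x => x + ε) A hlog, cfc_add_const ε (fun x => x) A, cfc_id' ℝ A]
  rfl

theorem cfc_log_add_le {A B : Matrix n n ℂ} (hA : A.PosSemidef) (hAB : A ≤ B) {ε : ℝ}
    (hε : 0 < ε) :
    cfc (fun x => Real.log (x + ε)) A ≤ cfc (fun x => Real.log (x + ε)) B := by
  have hB : B.PosSemidef := Matrix.nonneg_iff_posSemidef.mp (hA.nonneg.trans hAB)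
  rw [← log_add_algebraMap hA hε, ← log_add_algebraMap hB hε]
  exact CFC.log_le_log (by gcongr)
    (IsStrictlyPositive.nonneg_add hA.nonneg (isStrictlyPositive_algebraMap hε))

theorem Matrix.PosSemidef.re_trace_mul_le {ρ X Y : Matrix n n ℂ} (hρ : ρ.PosSemidef)
    (hXY : X ≤ Y) : (ρ * X).trace.re ≤ (ρ * Y).trace.re := by
  obtain ⟨B, rfl⟩ := CStarAlgebra.nonneg_iff_eq_star_mul_self.mp hρ.nonneg
  have h := (Matrix.PosSemidef.mul_mul_conjTranspose_same hXY B).trace_nonneg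
  rw [mul_assoc, Matrix.trace_mul_comm, mul_assoc, Matrix.trace_mul_comm] at h
  have h := (Complex.le_def.mp h).1
  rw [← Matrix.star_eq_conjTranspose, mul_sub, Matrix.trace_sub] at h
  simpa using h

end

/-- Antimonotonicity of relative entropy in the second argument:
if `ρ` is a density matrix, `σ ≤ τ` in the Loewner order (i.e. `τ - σ` is positive
semidefinite) and `supp ρ ⊆ supp σ`, then `S(ρ‖σ) ≥ S(ρ‖τ)`. -/
theorem relEnt_antimono_right {n : Type*} [Fintype n] [DecidableEq n]
    (ρ σ τ : Matrix n n ℂ) (hρ : ρ.PosSemidef) (hσ : σ.PosSemidef) (hτ : τ.PosSemidef)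
    (hρ1 : ρ.trace = 1)
    (hsupp : ∀ x : n → ℂ, σ.mulVec x = 0 → ρ.mulVec x = 0)
    (hle : (τ - σ).PosSemidef) :
    relEnt ρ σ ≥ relEnt ρ τ := by
  have hσ_lim := (Complex.continuous_re.tendsto _).comp (tendsto_trace_mul_log_add hσ.1 hsupp)
  have hτ_lim := (Complex.continuous_re.tendsto _).comp (tendsto_trace_mul_log_add hτ.1
    fun x hx => hsupp x (hσ.mulVec_eq_zero_of_le hle hx))
  have h := le_of_tendsto_of_tendsto hσ_lim hτ_lim <| by
    filter_upwards [self_mem_nhdsWithin] with ε hε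
    exact hρ.re_trace_mul_le (cfc_log_add_le hσ hle hε)
  simp only [relEnt, Complex.sub_re, matrixLog_eq_cfc hσ.1, matrixLog_eq_cfc hτ.1]
  linarith
end

section
/- Single-measurement entropic bound: for any density matrix ρ on C^d and any orthonormal basis v = {|v_j⟩}, the Shannon entropy of the distribution p_j = ⟨v_j|ρ|v_j⟩ satisfies H(p) ≥ -log max_j ‖Π |v_j⟩‖², where Π is any orthogonal projection whose range contains the support of ρ. -/
open scoped ComplexOrder

open Matrix in
open scoped MatrixOrder in
theorem Matrix.PosSemidef.exists_eq_conjTranspose_mul_self {n : Type*} [Fintype n]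
    {A : Matrix n n ℂ} (hA : A.PosSemidef) : ∃ B : Matrix n n ℂ, A = Bᴴ * B := by
  classical exact CStarAlgebra.nonneg_iff_eq_star_mul_self.mp hA.nonneg

open Matrix in
/-- The quadratic form of a Gram matrix is a sum of squared norms. -/
theorem re_star_dotProduct_conjTranspose_mul_self_mulVec {m n : Type*} [Fintype m] [Fintype n]
    (B : Matrix m n ℂ) (x : n → ℂ) :
    (star x ⬝ᵥ (Bᴴ * B) *ᵥ x).re = ∑ k, ‖(B *ᵥ x) k‖ ^ 2 := by
  rw [← mulVec_mulVec, dotProduct_mulVec, ← star_mulVec]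
  simp only [dotProduct, Pi.star_apply, Complex.re_sum, RCLike.star_def, Complex.conj_mul']
  norm_cast

open Matrix in
/-- The trace of a Gram matrix is the sum of the squared norms of the entries. -/
theorem re_trace_conjTranspose_mul_self {m n : Type*} [Fintype m] [Fintype n]
    (B : Matrix m n ℂ) : (Bᴴ * B).trace.re = ∑ k, ∑ i, ‖B k i‖ ^ 2 := by
  rw [Finset.sum_comm]
  simp only [trace, diag_apply, mul_apply, conjTranspose_apply, Complex.re_sum, RCLike.star_def,
    Complex.conj_mul']
  norm_cast

open Matrix in
theorem mulVec_apply_eq_inner {m n : Type*} [Fintype n] (B : Matrix m n ℂ)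
    (x : EuclideanSpace ℂ n) (k : m) :
    (B *ᵥ x) k = inner ℂ (WithLp.toLp 2 (star (B k)) : EuclideanSpace ℂ n) x := by
  simp [PiLp.inner_apply, mulVec, dotProduct, mul_comm]

open Matrix in
/-- The operator norm is bounded by the Frobenius norm. -/
theorem sum_norm_mulVec_sq_le {m n : Type*} [Fintype m] [Fintype n]
    (B : Matrix m n ℂ) (x : n → ℂ) :
    ∑ k, ‖(B *ᵥ x) k‖ ^ 2 ≤ (∑ k, ∑ i, ‖B k i‖ ^ 2) * ∑ i, ‖x i‖ ^ 2 := by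
  rw [Finset.sum_mul]
  refine Finset.sum_le_sum fun k _ => ?_
  have h := norm_inner_le_norm (𝕜 := ℂ)
    (WithLp.toLp 2 (star (B k)) : EuclideanSpace ℂ n) (WithLp.toLp 2 x)
  rw [← mulVec_apply_eq_inner] at h
  have h2 := pow_le_pow_left₀ (norm_nonneg _) h 2
  simpa [mul_pow, EuclideanSpace.norm_sq_eq] using h2

open Matrix in
/-- The Frobenius norm can be computed in any orthonormal basis. -/
theorem sum_sum_norm_mulVec_sq_eq {m n ι : Type*} [Fintype m] [Fintype n] [Fintype ι]
    (B : Matrix m n ℂ) (v : OrthonormalBasis ι ℂ (EuclideanSpace ℂ n)) :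
    ∑ j, ∑ k, ‖(B *ᵥ (v j)) k‖ ^ 2 = ∑ k, ∑ i, ‖B k i‖ ^ 2 := by
  rw [Finset.sum_comm]
  refine Finset.sum_congr rfl fun k _ => ?_
  simp only [mulVec_apply_eq_inner]
  rw [OrthonormalBasis.sum_sq_norm_inner_left]
  simp [EuclideanSpace.norm_sq_eq]

/-- The Shannon entropy of a probability distribution bounded by `M` is at least `-log M`. -/
theorem neg_log_le_neg_sum_mul_log {ι : Type*} [Fintype ι] {p : ι → ℝ} {M : ℝ}
    (h0 : ∀ j, 0 ≤ p j) (h1 : ∑ j, p j = 1) (hM : ∀ j, p j ≤ M) :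
    -Real.log M ≤ -∑ j, p j * Real.log (p j) := by
  rw [neg_le_neg_iff]
  calc ∑ j, p j * Real.log (p j) ≤ ∑ j, p j * Real.log M := by
        refine Finset.sum_le_sum fun j _ => ?_
        rcases (h0 j).eq_or_lt with h | h
        · simp [← h]
        · exact mul_le_mul_of_nonneg_left (Real.log_le_log h (hM j)) h.le
    _ = Real.log M := by rw [← Finset.sum_mul, h1, one_mul]

/-- Single-measurement entropic bound: for any density matrix `ρ` on `ℂ^d`
and any orthonormal basis `v`, the Shannon entropy of `p j = ⟨v j, ρ v j⟩` satisfies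
`H(p) ≥ -log max_j ‖Π (v j)‖²`, where `Π` is any orthogonal projection whose range
contains the support of `ρ` (expressed as `Π * ρ = ρ`). -/
theorem shannon_entropy_measurement_bound (d : ℕ) (hd : 0 < d)
    (ρ : Matrix (Fin d) (Fin d) ℂ) (hρ : ρ.PosSemidef) (hρ1 : ρ.trace = 1)
    (v : OrthonormalBasis (Fin d) ℂ (EuclideanSpace ℂ (Fin d)))
    (Pr : Matrix (Fin d) (Fin d) ℂ) (hPrh : Pr.IsHermitian) (hPri : Pr * Pr = Pr)
    (hsupp : Pr * ρ = ρ)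
    (p : Fin d → ℝ)
    (hp : ∀ j, p j = (∑ i, (starRingEnd ℂ) (v j i) * ρ.mulVec (⇑(v j)) i).re) :
    (-∑ j, p j * Real.log (p j)) ≥
      -Real.log (⨆ j, ∑ i, ‖Pr.mulVec (⇑(v j)) i‖ ^ 2) := by
  obtain ⟨B, rfl⟩ : ∃ B : Matrix (Fin d) (Fin d) ℂ, ρ = B.conjTranspose * B :=
    hρ.exists_eq_conjTranspose_mul_self
  have htr : ∑ k, ∑ i, ‖B k i‖ ^ 2 = 1 := by
    rw [← re_trace_conjTranspose_mul_self, hρ1, Complex.one_re]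
  have hpB (j) : p j = ∑ k, ‖(B.mulVec (v j)) k‖ ^ 2 :=
    (hp j).trans (re_star_dotProduct_conjTranspose_mul_self_mulVec B (v j))
  have hcomp : B.conjTranspose * B = (B * Pr).conjTranspose * (B * Pr) := by
    have hright : B.conjTranspose * B * Pr = B.conjTranspose * B := by
      simpa [Matrix.conjTranspose_mul, hPrh.eq, Matrix.mul_assoc] using
        congrArg Matrix.conjTranspose hsupp
    rw [Matrix.conjTranspose_mul, hPrh.eq, Matrix.mul_assoc,
      ← Matrix.mul_assoc B.conjTranspose, hright, hsupp]
  have hle (j) : p j ≤ ∑ i, ‖(Pr.mulVec (v j)) i‖ ^ 2 := by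
    rw [hpB, ← re_star_dotProduct_conjTranspose_mul_self_mulVec, hcomp,
      re_star_dotProduct_conjTranspose_mul_self_mulVec, ← Matrix.mulVec_mulVec]
    simpa [htr] using sum_norm_mulVec_sq_le B (Pr.mulVec (v j))
  refine neg_log_le_neg_sum_mul_log (fun j => ?_) ?_ fun j => ?_
  · rw [hpB]; positivity
  · simp only [hpB, sum_sum_norm_mulVec_sq_eq, htr]
  · exact (hle j).trans (le_ciSup (f := fun j => ∑ i, ‖(Pr.mulVec (v j)) i‖ ^ 2)
      (Set.finite_range _).bddAbove j)
end

section
/- Uncertainty principle with quantum side information for mutually unbiased bases: if ρ_{abc} is a density matrix on H_a ⊗ H_b ⊗ H_c with dim H_a = d and v, w are mutually unbiased orthonormal bases of H_a (|⟨v_j|w_k⟩|² = 1/d), then H(v|c) + H(w|b) ≥ log d, where H(v|c) := H(v) - χ(v,c) with χ(v,c) = S(ρ_c) - Σ_j p_j S(ρ_{c,j}). -/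
open scoped ComplexOrder InnerProductSpace

/-- The von Neumann entropy `S(A) = -∑ λᵢ log λᵢ` of a Hermitian matrix, via its
eigenvalues (junk value `0` for non-Hermitian matrices). -/
noncomputable def vNEntropy {n : Type*} [Fintype n] [DecidableEq n]
    (A : Matrix n n ℂ) : ℝ :=
  if hA : A.IsHermitian then -∑ i, hA.eigenvalues i * Real.log (hA.eigenvalues i)
  else 0

section ScalarMonotonicity

/-- For `0 ≤ l`, `0 < m` and `0 ≤ t`, the function `s ↦ l * (log (m + s * l) - log m)` has
derivative `l ^ 2 / (m + t * l)` at `t`. -/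
lemma hasDerivAt_mul_log_add_mul {l m t : ℝ} (hl : 0 ≤ l) (hm : 0 < m) (ht : 0 ≤ t) :
    HasDerivAt (fun s => l * (Real.log (m + s * l) - Real.log m)) (l ^ 2 / (m + t * l)) t := by
  have h1 : HasDerivAt (fun s : ℝ => m + s * l) l t := by
    simpa using ((hasDerivAt_id t).mul_const l).const_add m
  have hpos : 0 < m + t * l := by positivity
  refine (((h1.log hpos.ne').sub_const (Real.log m)).const_mul l).congr_deriv ?_
  rw [pow_two, mul_div_assoc]

lemma tendsto_mul_log_add_mul {l m : ℝ} (hl : 0 ≤ l) (hm : 0 < m) :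
    Filter.Tendsto (fun s => l * (Real.log (m + s * l) - Real.log m) - l * Real.log s)
      Filter.atTop (nhds (l * (Real.log l - Real.log m))) := by
  rcases hl.eq_or_lt with rfl | hl
  · simp
  have h1 : Filter.Tendsto (fun s : ℝ => m * s⁻¹ + l) Filter.atTop (nhds (m * 0 + l)) :=
    (tendsto_inv_atTop_zero.const_mul m).add_const l
  rw [mul_zero, zero_add] at h1
  have h2 := (((Real.continuousAt_log hl.ne').tendsto.comp h1).sub_const (Real.log m)).const_mul l
  refine h2.congr' ?_
  filter_upwards [Filter.eventually_gt_atTop 0] with s hs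
  have : m + s * l = s * (m * s⁻¹ + l) := by field_simp
  simp only [Function.comp_apply]
  rw [this, Real.log_mul hs.ne' (by positivity)]
  ring

lemma hasDerivAt_and_tendsto_sum_mul_log {ι : Type*} [Fintype ι] (w l m : ι → ℝ)
    (hl : ∀ i, 0 ≤ l i) (hm : ∀ i, 0 ≤ m i) (h0 : ∀ i, m i = 0 → w i * l i = 0) :
    (∀ t, 0 ≤ t → HasDerivAt
      (fun s => ∑ i, w i * (l i * (Real.log (m i + s * l i) - Real.log (m i))))
      (∑ i, w i * (l i ^ 2 / (m i + t * l i))) t) ∧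
    Filter.Tendsto (fun s => ∑ i, w i * (l i * (Real.log (m i + s * l i) - Real.log (m i))) -
      (∑ i, w i * l i) * Real.log s) Filter.atTop
      (nhds (∑ i, w i * (l i * (Real.log (l i) - Real.log (m i))))) := by
  constructor
  · intro t ht
    refine HasDerivAt.fun_sum fun i _ => ?_
    rcases (hm i).eq_or_lt with h | h
    · have h1 := h0 i h.symm
      have h2 : (fun s => w i * (l i * (Real.log (m i + s * l i) - Real.log (m i)))) =
          fun _ => 0 := by
        funext s; rw [← mul_assoc, h1, zero_mul]
      have h3 : w i * (l i ^ 2 / (m i + t * l i)) = 0 := by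
        rw [pow_two, mul_div_assoc, ← mul_assoc, h1, zero_mul]
      rw [h2, h3]
      exact hasDerivAt_const _ _
    · exact (hasDerivAt_mul_log_add_mul (hl i) h ht).const_mul _
  · simp_rw [Finset.sum_mul, ← Finset.sum_sub_distrib]
    refine tendsto_finsetSum _ fun i _ => ?_
    rcases (hm i).eq_or_lt with h | h
    · have h1 := h0 i h.symm
      simp [← mul_assoc, h1]
    · refine ((tendsto_mul_log_add_mul (hl i) h).const_mul (w i)).congr fun s => ?_
      ring

/-- Weighted sums of `l * log (l / m)` are compared by comparing the weighted sums of
`l ^ 2 / (m + s * l)` for every `s > 0`. -/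
lemma sum_mul_log_sub_log_le {ι κ : Type*} [Fintype ι] [Fintype κ]
    (w l m : ι → ℝ) (w' l' m' : κ → ℝ)
    (hl : ∀ i, 0 ≤ l i) (hm : ∀ i, 0 ≤ m i) (h0 : ∀ i, m i = 0 → w i * l i = 0)
    (hl' : ∀ i, 0 ≤ l' i) (hm' : ∀ i, 0 ≤ m' i) (h0' : ∀ i, m' i = 0 → w' i * l' i = 0)
    (hsum : ∑ i, w' i * l' i = ∑ i, w i * l i)
    (hle : ∀ s > 0, ∑ i, w' i * (l' i ^ 2 / (m' i + s * l' i)) ≤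
      ∑ i, w i * (l i ^ 2 / (m i + s * l i))) :
    ∑ i, w' i * (l' i * (Real.log (l' i) - Real.log (m' i))) ≤
      ∑ i, w i * (l i * (Real.log (l i) - Real.log (m i))) := by
  obtain ⟨hd, ht⟩ := hasDerivAt_and_tendsto_sum_mul_log w l m hl hm h0
  obtain ⟨hd', ht'⟩ := hasDerivAt_and_tendsto_sum_mul_log w' l' m' hl' hm' h0'
  refine le_of_tendsto_of_tendsto ht' ht ?_
  filter_upwards [Filter.eventually_ge_atTop 0] with T hT
  rw [hsum]
  refine sub_le_sub_right ?_ _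
  have hmono := monotoneOn_of_deriv_nonneg (convex_Ici (0 : ℝ))
    (fun t ht => ((hd t ht).sub (hd' t ht)).continuousAt.continuousWithinAt)
    (fun t ht => by
      rw [interior_Ici] at ht
      exact ((hd t ht.le).sub (hd' t ht.le)).differentiableAt.differentiableWithinAt)
    (fun t ht => by
      rw [interior_Ici] at ht
      rw [((hd t ht.le).sub (hd' t ht.le)).deriv]
      exact sub_nonneg.2 (hle t ht))
  have := hmono Set.self_mem_Ici hT hT
  simpa using this

end ScalarMonotonicity

section Entropy

open Matrix

/-- The unitary `V` diagonalizes `A` with real eigenvalues `l`. -/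
structure Diagonalizes {n : Type*} [Fintype n] [DecidableEq n] (V : Matrix n n ℂ) (l : n → ℝ)
    (A : Matrix n n ℂ) : Prop where
  isometry : Vᴴ * V = 1
  eq_mul : A = V * diagonal (fun i => (l i : ℂ)) * Vᴴ

namespace Diagonalizes

variable {n : Type*} [Fintype n] [DecidableEq n] {V A : Matrix n n ℂ} {l : n → ℝ}

lemma mul_conjTranspose (h : Diagonalizes V l A) : V * Vᴴ = 1 :=
  mul_eq_one_comm.1 h.isometry

lemma isHermitian (h : Diagonalizes V l A) : A.IsHermitian := by
  rw [h.eq_mul, IsHermitian, conjTranspose_mul, conjTranspose_mul, conjTranspose_conjTranspose,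
    diagonal_conjTranspose, Matrix.mul_assoc]
  congr 3
  ext i
  simp

lemma smul (h : Diagonalizes V l A) (c : ℝ) : Diagonalizes V (fun i => c * l i) ((c : ℂ) • A) where
  isometry := h.isometry
  eq_mul := by
    have : diagonal (fun i => ((c * l i : ℝ) : ℂ)) = (c : ℂ) • diagonal (fun i => (l i : ℂ)) := by
      ext i j
      by_cases hij : i = j <;> simp [hij, diagonal]
    rw [this, h.eq_mul]
    simp

lemma charpoly_eq (h : Diagonalizes V l A) :
    A.charpoly = ∏ i, (Polynomial.X - Polynomial.C (l i : ℂ)) := by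
  rw [h.eq_mul, charpoly_mul_comm, ← Matrix.mul_assoc, h.isometry, Matrix.one_mul,
    charpoly_diagonal]

lemma trace_re (h : Diagonalizes V l A) : A.trace.re = ∑ i, l i := by
  rw [h.eq_mul, trace_mul_comm, ← Matrix.mul_assoc, h.isometry, Matrix.one_mul,
    trace_diagonal]
  simp

end Diagonalizes

lemma Matrix.IsHermitian.diagonalizes {n : Type*} [Fintype n] [DecidableEq n]
    {A : Matrix n n ℂ} (hA : A.IsHermitian) :
    Diagonalizes (hA.eigenvectorUnitary : Matrix n n ℂ) hA.eigenvalues A where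
  isometry := Unitary.coe_star_mul_self _
  eq_mul := by
    conv_lhs => rw [hA.spectral_theorem, Unitary.conjStarAlgAut_apply]
    rfl

lemma vNEntropy_eq_roots {n : Type*} [Fintype n] [DecidableEq n] {A : Matrix n n ℂ}
    (hA : A.IsHermitian) :
    vNEntropy A = (A.charpoly.roots.map fun z => Real.negMulLog z.re).sum := by
  rw [vNEntropy, dif_pos hA, hA.roots_charpoly_eq_eigenvalues, Multiset.map_map]
  simp [Real.negMulLog, ← Finset.sum_neg_distrib]

lemma Diagonalizes.vNEntropy_eq {n : Type*} [Fintype n] [DecidableEq n] {V A : Matrix n n ℂ}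
    {l : n → ℝ} (h : Diagonalizes V l A) : vNEntropy A = ∑ i, Real.negMulLog (l i) := by
  rw [vNEntropy_eq_roots h.isHermitian, h.charpoly_eq, Polynomial.roots_prod _ _
    (Finset.prod_ne_zero_iff.2 fun i _ => Polynomial.X_sub_C_ne_zero _)]
  simp

lemma vNEntropy_transpose {n : Type*} [Fintype n] [DecidableEq n] {A : Matrix n n ℂ}
    (hA : A.IsHermitian) : vNEntropy Aᵀ = vNEntropy A := by
  rw [vNEntropy_eq_roots hA, vNEntropy_eq_roots hA.transpose, charpoly_transpose]

/-- The two marginals of a pure state have equal entropies. -/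
lemma vNEntropy_mul_conjTranspose {m n : Type*} [Fintype m] [DecidableEq m] [Fintype n]
    [DecidableEq n] (N : Matrix m n ℂ) : vNEntropy (N * Nᴴ) = vNEntropy (Nᴴ * N) := by
  rw [vNEntropy_eq_roots (isHermitian_mul_conjTranspose_self N),
    vNEntropy_eq_roots (isHermitian_conjTranspose_mul_self N)]
  have h := congrArg (fun p => (p.roots.map fun z => Real.negMulLog z.re).sum)
    (charpoly_mul_comm' N Nᴴ)
  simpa [Polynomial.roots_mul, (charpoly_monic _).ne_zero, Multiset.map_nsmul,
    Multiset.sum_nsmul] using h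

lemma Matrix.PosSemidef.exists_diagonalizes {n : Type*} [Fintype n] [DecidableEq n]
    {A : Matrix n n ℂ} (hA : A.PosSemidef) :
    ∃ (V : Matrix n n ℂ) (l : n → ℝ), (∀ i, 0 ≤ l i) ∧ Diagonalizes V l A :=
  ⟨_, _, hA.eigenvalues_nonneg, hA.isHermitian.diagonalizes⟩

/-- Entropy of an unnormalized state in terms of the normalized one. -/
lemma negMulLog_trace_add_vNEntropy {n : Type*} [Fintype n] [DecidableEq n] {A : Matrix n n ℂ}
    (hA : A.PosSemidef) {p : ℝ} (hp : p = A.trace.re) :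
    Real.negMulLog p + p * vNEntropy ((p : ℂ)⁻¹ • A) = vNEntropy A := by
  obtain ⟨V, l, hl0, hd⟩ := hA.exists_diagonalizes
  have hs := hd.smul p⁻¹
  rw [Complex.ofReal_inv] at hs
  rw [hs.vNEntropy_eq, hd.vNEntropy_eq]
  rw [hd.trace_re] at hp
  by_cases h0 : p = 0
  · have hl : ∀ i, l i = 0 := by
      intro i
      rw [h0] at hp
      exact (Finset.sum_eq_zero_iff_of_nonneg fun i _ => hl0 i).1 hp.symm i (Finset.mem_univ i)
    simp [h0, hl]
  · simp_rw [Real.negMulLog_mul, Finset.sum_add_distrib, ← Finset.mul_sum, ← Finset.sum_mul]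
    rw [← hp]
    simp only [Real.negMulLog, Real.log_inv]
    field_simp
    ring

/-- A positive semidefinite matrix has a factorization `B * Bᴴ`. -/
lemma Matrix.PosSemidef.exists_eq_mul_conjTranspose {n : Type*} [Fintype n] [DecidableEq n]
    {A : Matrix n n ℂ} (hA : A.PosSemidef) : ∃ B : Matrix n n ℂ, A = B * Bᴴ := by
  obtain ⟨V, l, hl, hd⟩ := hA.exists_diagonalizes
  refine ⟨V * diagonal fun i => (√(l i) : ℂ), ?_⟩
  have : diagonal (fun i => (l i : ℂ)) =
      diagonal (fun i => (√(l i) : ℂ)) * (diagonal fun i => (√(l i) : ℂ))ᴴ := by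
    rw [diagonal_conjTranspose, diagonal_mul_diagonal]
    congr 1
    ext i
    simp [← Complex.ofReal_mul, Real.mul_self_sqrt (hl i)]
  rw [hd.eq_mul, this, conjTranspose_mul]
  simp only [Matrix.mul_assoc]

end Entropy

section RelativeEntropy

open Matrix

/-- The quadratic functional whose supremum over `X` is the resolvent term in the integral
representation of the relative entropy of `R` and `T`. -/
noncomputable def resolventForm {n : Type*} [Fintype n] (R T : Matrix n n ℂ) (s : ℝ)
    (X : Matrix n n ℂ) : ℝ :=
  2 * (R * X).trace.re - (Xᴴ * T * X).trace.re - s * (X * R * Xᴴ).trace.re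

/-- The relative entropy of two matrices given by their eigenvectors and eigenvalues. -/
noncomputable def spectralRelEntropy {n : Type*} [Fintype n] (V : Matrix n n ℂ) (l : n → ℝ)
    (W : Matrix n n ℂ) (μ : n → ℝ) : ℝ :=
  ∑ ij : n × n, Complex.normSq ((Vᴴ * W) ij.1 ij.2) *
    (l ij.1 * (Real.log (l ij.1) - Real.log (μ ij.2)))

section

variable {n : Type*} [Fintype n] [DecidableEq n] {V W R T : Matrix n n ℂ} {l μ : n → ℝ}

lemma resolventForm_conj (hR : Diagonalizes V l R) (hT : Diagonalizes W μ T) (s : ℝ)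
    (Y : Matrix n n ℂ) :
    resolventForm R T s (W * Y * Vᴴ) = ∑ ij : n × n,
      (2 * (l ij.1 * (((Vᴴ * W) ij.1 ij.2) * Y ij.2 ij.1).re) -
        (μ ij.2 + s * l ij.1) * Complex.normSq (Y ij.2 ij.1)) := by
  have h1 : (R * (W * Y * Vᴴ)).trace =
      (diagonal (fun i => (l i : ℂ)) * ((Vᴴ * W) * Y)).trace := by
    rw [← Matrix.mul_assoc, trace_mul_comm, hR.eq_mul]
    calc (Vᴴ * (V * diagonal (fun i => (l i : ℂ)) * Vᴴ * (W * Y))).trace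
        = ((Vᴴ * V) * diagonal (fun i => (l i : ℂ)) * ((Vᴴ * W) * Y)).trace := by
          simp only [Matrix.mul_assoc]
      _ = _ := by rw [hR.isometry, Matrix.one_mul]
  have h2 : ((W * Y * Vᴴ)ᴴ * T * (W * Y * Vᴴ)).trace =
      (Yᴴ * (diagonal (fun i => (μ i : ℂ)) * Y)).trace := by
    rw [← Matrix.mul_assoc, trace_mul_comm, hT.eq_mul, conjTranspose_mul, conjTranspose_mul,
      conjTranspose_conjTranspose]
    calc (Vᴴ * (V * (Yᴴ * Wᴴ) * (W * diagonal (fun i => (μ i : ℂ)) * Wᴴ) * (W * Y))).trace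
        = ((Vᴴ * V) * Yᴴ * (Wᴴ * W) * diagonal (fun i => (μ i : ℂ)) * (Wᴴ * W) * Y).trace := by
          simp only [Matrix.mul_assoc]
      _ = _ := by simp only [hR.isometry, hT.isometry, Matrix.one_mul, Matrix.mul_one,
            Matrix.mul_assoc]
  have h3 : ((W * Y * Vᴴ) * R * (W * Y * Vᴴ)ᴴ).trace =
      (Y * (diagonal (fun i => (l i : ℂ)) * Yᴴ)).trace := by
    rw [hR.eq_mul, conjTranspose_mul, conjTranspose_mul, conjTranspose_conjTranspose,
      ← Matrix.mul_assoc V, ← Matrix.mul_assoc, trace_mul_comm]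
    calc (Wᴴ * (W * Y * Vᴴ * (V * diagonal (fun i => (l i : ℂ)) * Vᴴ) * (V * Yᴴ))).trace
        = ((Wᴴ * W) * Y * (Vᴴ * V) * diagonal (fun i => (l i : ℂ)) * (Vᴴ * V) * Yᴴ).trace := by
          simp only [Matrix.mul_assoc]
      _ = _ := by simp only [hR.isometry, hT.isometry, Matrix.one_mul, Matrix.mul_one,
            Matrix.mul_assoc]
  rw [resolventForm, h1, h2, h3]
  generalize Vᴴ * W = G
  have e1 : (diagonal (fun i => (l i : ℂ)) * (G * Y)).trace.re =
      ∑ i, ∑ j, l i * (G i j * Y j i).re := by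
    simp only [trace, diag_apply, diagonal_mul, Complex.re_sum, mul_apply (M := G),
      Finset.mul_sum, Complex.re_ofReal_mul]
  have e2 : (Yᴴ * (diagonal (fun i => (μ i : ℂ)) * Y)).trace.re =
      ∑ i, ∑ j, μ j * Complex.normSq (Y j i) := by
    simp only [trace, diag_apply, mul_apply (M := Yᴴ), diagonal_mul, Complex.re_sum,
      conjTranspose_apply]
    refine Finset.sum_congr rfl fun i _ => Finset.sum_congr rfl fun j _ => ?_
    simp [Complex.normSq_apply]
    ring
  have e3 : (Y * (diagonal (fun i => (l i : ℂ)) * Yᴴ)).trace.re =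
      ∑ i, ∑ j, l i * Complex.normSq (Y j i) := by
    simp only [trace, diag_apply, mul_apply (M := Y), diagonal_mul, Complex.re_sum,
      conjTranspose_apply]
    rw [Finset.sum_comm]
    refine Finset.sum_congr rfl fun i _ => Finset.sum_congr rfl fun j _ => ?_
    simp [Complex.normSq_apply]
    ring
  rw [e1, e2, e3, Fintype.sum_prod_type]
  simp only [Finset.mul_sum, ← Finset.sum_sub_distrib]
  refine Finset.sum_congr rfl fun i _ => Finset.sum_congr rfl fun j _ => ?_
  ring

lemma two_mul_re_sub_le {l m s : ℝ} (hl : 0 ≤ l) (hm : 0 ≤ m) (hs : 0 < s) (g y : ℂ) :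
    2 * (l * (g * y).re) - (m + s * l) * Complex.normSq y ≤
      Complex.normSq g * (l ^ 2 / (m + s * l)) := by
  rcases hl.eq_or_lt with rfl | hl
  · simpa using mul_nonneg hm (Complex.normSq_nonneg y)
  have hp : 0 < m + s * l := by positivity
  rw [mul_div_assoc', le_div_iff₀ hp]
  simp only [Complex.normSq_apply, Complex.mul_re]
  nlinarith [sq_nonneg (l * g.re - (m + s * l) * y.re), sq_nonneg (l * g.im + (m + s * l) * y.im)]

lemma two_mul_re_sub_eq {l m s : ℝ} (hl : 0 ≤ l) (hm : 0 ≤ m) (hs : 0 < s) (g : ℂ) :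
    2 * (l * (g * ((l / (m + s * l) : ℝ) * (starRingEnd ℂ) g)).re) -
      (m + s * l) * Complex.normSq ((l / (m + s * l) : ℝ) * (starRingEnd ℂ) g) =
      Complex.normSq g * (l ^ 2 / (m + s * l)) := by
  rcases hl.eq_or_lt with rfl | hl
  · simp
  have hp : m + s * l ≠ 0 := by positivity
  rw [Complex.normSq_mul, Complex.normSq_conj, Complex.normSq_ofReal, mul_left_comm g,
    Complex.mul_conj, ← Complex.ofReal_mul, Complex.ofReal_re]
  field_simp
  ring

lemma resolventForm_le (hR : Diagonalizes V l R) (hT : Diagonalizes W μ T) (hl : ∀ i, 0 ≤ l i)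
    (hμ : ∀ i, 0 ≤ μ i) {s : ℝ} (hs : 0 < s) (X : Matrix n n ℂ) :
    resolventForm R T s X ≤ ∑ ij : n × n, Complex.normSq ((Vᴴ * W) ij.1 ij.2) *
      (l ij.1 ^ 2 / (μ ij.2 + s * l ij.1)) := by
  have hX : X = W * (Wᴴ * X * V) * Vᴴ := by
    calc X = (W * Wᴴ) * X * (V * Vᴴ) := by
          rw [hR.mul_conjTranspose, hT.mul_conjTranspose, Matrix.one_mul, Matrix.mul_one]
      _ = _ := by simp only [Matrix.mul_assoc]
  rw [hX, resolventForm_conj hR hT]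
  exact Finset.sum_le_sum fun ij _ => two_mul_re_sub_le (hl _) (hμ _) hs _ _

lemma exists_resolventForm_eq (hR : Diagonalizes V l R) (hT : Diagonalizes W μ T)
    (hl : ∀ i, 0 ≤ l i) (hμ : ∀ i, 0 ≤ μ i) {s : ℝ} (hs : 0 < s) :
    ∃ X, resolventForm R T s X = ∑ ij : n × n, Complex.normSq ((Vᴴ * W) ij.1 ij.2) *
      (l ij.1 ^ 2 / (μ ij.2 + s * l ij.1)) := by
  refine ⟨W * (of fun j i => ((l i / (μ j + s * l i) : ℝ) : ℂ) *
    (starRingEnd ℂ) ((Vᴴ * W) i j)) * Vᴴ, ?_⟩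
  rw [resolventForm_conj hR hT]
  exact Finset.sum_congr rfl fun ij _ => two_mul_re_sub_eq (hl _) (hμ _) hs _

lemma re_conj_diag (hR : Diagonalizes V l R) (W : Matrix n n ℂ) (j : n) :
    ((Wᴴ * R * W) j j).re = ∑ i, Complex.normSq ((Vᴴ * W) i j) * l i := by
  have : Wᴴ * R * W = (Vᴴ * W)ᴴ * (diagonal (fun i => (l i : ℂ)) * (Vᴴ * W)) := by
    rw [hR.eq_mul, conjTranspose_mul, conjTranspose_conjTranspose]
    simp only [Matrix.mul_assoc]
  rw [this, mul_apply, Complex.re_sum]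
  refine Finset.sum_congr rfl fun i _ => ?_
  simp [diagonal_mul, Complex.normSq_apply]
  ring

lemma sum_normSq_row_s19 (hR : Diagonalizes V l R) (hT : Diagonalizes W μ T) (i : n) :
    ∑ j, Complex.normSq ((Vᴴ * W) i j) = 1 := by
  have h : (Vᴴ * W) * (Vᴴ * W)ᴴ = 1 := by
    rw [conjTranspose_mul, conjTranspose_conjTranspose]
    calc Vᴴ * W * (Wᴴ * V) = Vᴴ * (W * Wᴴ) * V := by simp only [Matrix.mul_assoc]
      _ = 1 := by rw [hT.mul_conjTranspose, Matrix.mul_one, hR.isometry]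
  have h2 := congrArg Complex.re (congrFun (congrFun h i) i)
  rw [mul_apply, Complex.re_sum] at h2
  simpa [Complex.normSq_apply] using h2

lemma sum_normSq_mul (hR : Diagonalizes V l R) (hT : Diagonalizes W μ T) :
    ∑ ij : n × n, Complex.normSq ((Vᴴ * W) ij.1 ij.2) * l ij.1 = R.trace.re := by
  rw [Fintype.sum_prod_type, hR.trace_re]
  refine Finset.sum_congr rfl fun i _ => ?_
  simp only
  rw [← Finset.sum_mul, sum_normSq_row_s19 hR hT, one_mul]

lemma spectralRelEntropy_eq (hR : Diagonalizes V l R) (hT : Diagonalizes W μ T) :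
    spectralRelEntropy V l W μ = -vNEntropy R - ∑ j, ((Wᴴ * R * W) j j).re * Real.log (μ j) := by
  rw [hR.vNEntropy_eq]
  simp only [re_conj_diag hR, Finset.sum_mul, spectralRelEntropy, Fintype.sum_prod_type]
  rw [Finset.sum_comm (s := Finset.univ) (t := Finset.univ)
    (f := fun j i => Complex.normSq ((Vᴴ * W) i j) * l i * Real.log (μ j)),
    ← Finset.sum_neg_distrib, ← Finset.sum_sub_distrib]
  refine Finset.sum_congr rfl fun i _ => ?_
  have h : -Real.negMulLog (l i) =
      ∑ j, Complex.normSq ((Vᴴ * W) i j) * (l i * Real.log (l i)) := by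
    rw [← Finset.sum_mul, sum_normSq_row_s19 hR hT]
    simp [Real.negMulLog]
  rw [h, ← Finset.sum_sub_distrib]
  refine Finset.sum_congr rfl fun j _ => ?_
  ring

lemma normSq_mul_eq_zero (hR : Diagonalizes V l R) (hl : ∀ i, 0 ≤ l i) {j : n}
    (h : ((Wᴴ * R * W) j j).re = 0) (i : n) : Complex.normSq ((Vᴴ * W) i j) * l i = 0 := by
  rw [re_conj_diag hR] at h
  exact (Finset.sum_eq_zero_iff_of_nonneg fun i _ =>
    mul_nonneg (Complex.normSq_nonneg _) (hl i)).1 h i (Finset.mem_univ i)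

end

section

variable {κ ε m n : Type*} [Fintype κ] [DecidableEq κ] [Fintype ε] [DecidableEq ε] [Fintype m]
  [DecidableEq m] [Fintype n] {B : κ → ε → Matrix m n ℂ}

lemma trace_sum_conj_mul_sum_conj
    (hB : ∀ k e k' e', B k e * (B k' e')ᴴ = if k = k' ∧ e = e' then 1 else 0)
    (A : Matrix n n ℂ) (Y Z : κ → Matrix m m ℂ) :
    ((∑ k, ∑ e, (B k e)ᴴ * Y k * B k e) * A * ∑ k, ∑ e, (B k e)ᴴ * Z k * B k e).trace =
      ∑ k, (Y k * (∑ e, B k e * A * (B k e)ᴴ) * Z k).trace := by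
  have hterm : ∀ k e k' e', (((B k e)ᴴ * Y k * B k e) * A *
      ((B k' e')ᴴ * Z k' * B k' e')).trace =
      if k = k' ∧ e = e' then (Y k * (B k e * A * (B k e)ᴴ) * Z k).trace else 0 := by
    intro k e k' e'
    calc (((B k e)ᴴ * Y k * B k e) * A * ((B k' e')ᴴ * Z k' * B k' e')).trace
        = (((B k e)ᴴ * Y k * B k e * A * (B k' e')ᴴ * Z k') * B k' e').trace := by
          simp only [Matrix.mul_assoc]
      _ = ((B k' e' * (B k e)ᴴ) * Y k * B k e * A * (B k' e')ᴴ * Z k').trace := by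
          rw [trace_mul_comm]; simp only [Matrix.mul_assoc]
      _ = _ := by
          rw [hB]
          by_cases h : k = k' ∧ e = e'
          · obtain ⟨rfl, rfl⟩ := h
            simp [Matrix.mul_assoc]
          · have h' : ¬ (k' = k ∧ e' = e) := fun hh => h ⟨hh.1.symm, hh.2.symm⟩
            simp [h, h']
  have hexp : ((∑ k, ∑ e, (B k e)ᴴ * Y k * B k e) * A *
      ∑ k, ∑ e, (B k e)ᴴ * Z k * B k e).trace = ∑ k, ∑ e, ∑ k', ∑ e',
        (((B k e)ᴴ * Y k * B k e) * A * ((B k' e')ᴴ * Z k' * B k' e')).trace := by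
    simp_rw [Matrix.sum_mul, Matrix.mul_sum, trace_sum]
  rw [hexp]
  refine Finset.sum_congr rfl fun k _ => ?_
  rw [Matrix.mul_sum, Matrix.sum_mul, trace_sum]
  refine Finset.sum_congr rfl fun e _ => ?_
  simp_rw [hterm]
  rw [Finset.sum_eq_single k (fun k' _ hk => Finset.sum_eq_zero fun e' _ =>
    if_neg fun h => hk h.1.symm) (by simp), Finset.sum_eq_single e (fun e' _ he =>
    if_neg fun h => he h.2.symm) (by simp), if_pos ⟨rfl, rfl⟩]

lemma resolventForm_sum_conj
    (hB : ∀ k e k' e', B k e * (B k' e')ᴴ = if k = k' ∧ e = e' then 1 else 0)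
    (R T : Matrix n n ℂ) (s : ℝ) (X : κ → Matrix m m ℂ) :
    resolventForm R T s (∑ k, ∑ e, (B k e)ᴴ * X k * B k e) =
      ∑ k, resolventForm (∑ e, B k e * R * (B k e)ᴴ) (∑ e, B k e * T * (B k e)ᴴ) s (X k) := by
  have h1 : (R * ∑ k, ∑ e, (B k e)ᴴ * X k * B k e).trace =
      ∑ k, ((∑ e, B k e * R * (B k e)ᴴ) * X k).trace := by
    simp only [Matrix.mul_sum, Matrix.sum_mul, trace_sum]
    refine Finset.sum_congr rfl fun k _ => Finset.sum_congr rfl fun e _ => ?_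
    rw [← Matrix.mul_assoc, trace_mul_comm]
    simp only [Matrix.mul_assoc]
  have hstar : (∑ k, ∑ e, (B k e)ᴴ * X k * B k e)ᴴ = ∑ k, ∑ e, (B k e)ᴴ * (X k)ᴴ * B k e := by
    simp only [conjTranspose_sum, conjTranspose_mul, conjTranspose_conjTranspose,
      Matrix.mul_assoc]
  rw [resolventForm, h1, hstar, trace_sum_conj_mul_sum_conj hB T (fun k => (X k)ᴴ) X,
    trace_sum_conj_mul_sum_conj hB R X fun k => (X k)ᴴ]
  simp only [resolventForm, Complex.re_sum, Finset.mul_sum, Finset.sum_sub_distrib]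

end

/-- Monotonicity of the relative entropy under the channel sending `A` to the block-diagonal
family `k ↦ ∑ e, B k e * A * (B k e)ᴴ`, where the `B k e` are coisometries onto orthogonal
subspaces spanning the whole space. -/
theorem sum_spectralRelEntropy_le {κ ε m n : Type*} [Fintype κ] [DecidableEq κ] [Fintype ε]
    [DecidableEq ε] [Fintype m] [DecidableEq m] [Fintype n] [DecidableEq n]
    {B : κ → ε → Matrix m n ℂ}
    (hB : ∀ k e k' e', B k e * (B k' e')ᴴ = if k = k' ∧ e = e' then 1 else 0)
    (hB1 : ∑ k, ∑ e, (B k e)ᴴ * B k e = 1)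
    {R T V W : Matrix n n ℂ} {l μ : n → ℝ} (hR : Diagonalizes V l R) (hT : Diagonalizes W μ T)
    (hl : ∀ i, 0 ≤ l i) (hμ : ∀ i, 0 ≤ μ i) (h0 : ∀ j, μ j = 0 → ((Wᴴ * R * W) j j).re = 0)
    {V' W' : κ → Matrix m m ℂ} {l' μ' : κ → m → ℝ}
    (hR' : ∀ k, Diagonalizes (V' k) (l' k) (∑ e, B k e * R * (B k e)ᴴ))
    (hT' : ∀ k, Diagonalizes (W' k) (μ' k) (∑ e, B k e * T * (B k e)ᴴ))
    (hl' : ∀ k i, 0 ≤ l' k i) (hμ' : ∀ k i, 0 ≤ μ' k i)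
    (h0' : ∀ k j, μ' k j = 0 →
      (((W' k)ᴴ * (∑ e, B k e * R * (B k e)ᴴ) * W' k) j j).re = 0) :
    ∑ k, spectralRelEntropy (V' k) (l' k) (W' k) (μ' k) ≤ spectralRelEntropy V l W μ := by
  have htrace : ∑ k, (∑ e, B k e * R * (B k e)ᴴ).trace.re = R.trace.re := by
    calc ∑ k, (∑ e, B k e * R * (B k e)ᴴ).trace.re
        = ((∑ k, ∑ e, (B k e)ᴴ * B k e) * R).trace.re := by
          simp only [Matrix.sum_mul, trace_sum, Complex.re_sum]
          refine Finset.sum_congr rfl fun k _ => Finset.sum_congr rfl fun e _ => ?_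
          rw [trace_mul_comm, Matrix.mul_assoc]
      _ = _ := by rw [hB1, Matrix.one_mul]
  have key := sum_mul_log_sub_log_le
    (fun ij : n × n => Complex.normSq ((Vᴴ * W) ij.1 ij.2)) (fun ij => l ij.1) (fun ij => μ ij.2)
    (fun x : κ × m × m => Complex.normSq (((V' x.1)ᴴ * W' x.1) x.2.1 x.2.2))
    (fun x => l' x.1 x.2.1) (fun x => μ' x.1 x.2.2) (fun _ => hl _) (fun _ => hμ _)
    (fun ij h => normSq_mul_eq_zero hR hl (h0 _ h) _) (fun _ => hl' _ _) (fun _ => hμ' _ _)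
    (fun x h => normSq_mul_eq_zero (hR' x.1) (hl' x.1) (h0' _ _ h) _) ?_ ?_
  · rw [Fintype.sum_prod_type] at key
    exact key
  · have h2 := fun k => sum_normSq_mul (hR' k) (hT' k)
    rw [Fintype.sum_prod_type]
    simp only [h2]
    rw [htrace, sum_normSq_mul hR hT]
  · intro s hs
    choose X hX using fun k => exists_resolventForm_eq (hR' k) (hT' k) (hl' k) (hμ' k) hs
    rw [Fintype.sum_prod_type]
    calc _ = ∑ k, resolventForm (∑ e, B k e * R * (B k e)ᴴ) (∑ e, B k e * T * (B k e)ᴴ) s (X k) :=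
          Finset.sum_congr rfl fun k _ => (hX k).symm
      _ ≤ _ := by
          rw [← resolventForm_sum_conj hB]
          exact resolventForm_le hR hT hl hμ hs _

end RelativeEntropy

section UncertaintyRelation

open Matrix

/-- The operator `⟨w_k| ⊗ 1 ⊗ ⟨e|`, where the bra `⟨w_k|` has components `U k a`. -/
def partialBra {α ε : Type*} (β : Type*) [DecidableEq β] [DecidableEq ε] (U : Matrix α α ℂ)
    (k : α) (e : ε) :
    Matrix β ((β × ε) × α) ℂ :=
  of fun b x => if x.1 = (b, e) then U k x.2 else 0

variable {α β ε : Type*} [Fintype α] [Fintype β] [DecidableEq β] [Fintype ε]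
  [DecidableEq ε] {U : Matrix α α ℂ}

lemma partialBra_mul_mul_apply (k : α) (e : ε) (A : Matrix ((β × ε) × α) ((β × ε) × α) ℂ)
    (b b' : β) :
    (partialBra β U k e * A * (partialBra β U k e)ᴴ) b b' =
      ∑ a, ∑ a', U k a * A ((b, e), a) ((b', e), a') * (starRingEnd ℂ) (U k a') := by
  simp only [mul_apply, partialBra, of_apply, conjTranspose_apply, Finset.sum_mul]
  rw [Finset.sum_comm]
  simp only [Fintype.sum_prod_type_right (α₁ := β × ε), ite_mul, zero_mul, apply_ite star,
    star_zero, mul_ite, mul_zero, Finset.sum_ite_eq', Finset.mem_univ, if_true]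
  refine Finset.sum_congr rfl fun a _ => ?_
  rw [Finset.sum_comm]
  simp only [Finset.sum_ite_eq', Finset.mem_univ, if_true]
  rfl

variable [DecidableEq α]

lemma partialBra_mul_conjTranspose (hU : U * Uᴴ = 1) (k : α) (e : ε) (k' : α) (e' : ε) :
    partialBra β U k e * (partialBra β U k' e')ᴴ =
      if k = k' ∧ e = e' then 1 else 0 := by
  ext b b'
  have h := congrFun (congrFun hU k) k'
  simp only [mul_apply, conjTranspose_apply] at h
  simp only [mul_apply, partialBra, of_apply, conjTranspose_apply,
    Fintype.sum_prod_type_right (α₁ := β × ε), ite_mul, zero_mul, apply_ite star, star_zero,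
    mul_ite, mul_zero, Finset.sum_ite_eq', Finset.mem_univ, if_true, Prod.mk.injEq]
  by_cases hb : b = b' <;> by_cases he : e = e' <;> by_cases hk : k = k' <;>
    simp_all [one_apply] <;> grind

lemma sum_conjTranspose_partialBra_mul (hU : Uᴴ * U = 1) :
    ∑ k, ∑ e : ε, (partialBra β U k e)ᴴ * partialBra β U k e = 1 := by
  ext x y
  obtain ⟨⟨b, e⟩, a⟩ := x
  obtain ⟨⟨b', e'⟩, a'⟩ := y
  have h := congrFun (congrFun hU a) a'
  simp only [mul_apply, conjTranspose_apply] at h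
  simp only [Matrix.sum_apply, mul_apply, partialBra, of_apply, conjTranspose_apply, ite_mul,
    zero_mul, apply_ite star, star_zero, mul_ite, mul_zero, Prod.mk.injEq, ite_and, Finset.sum_ite_eq,
    Finset.mem_univ, if_true]
  by_cases hb : b = b' <;> by_cases he : e = e' <;> by_cases ha : a = a' <;>
    simp_all [one_apply]

lemma sum_partialBra_mul_blockDiagonal {d : ℝ} (hU : Uᴴ * U = 1)
    (hd : ∀ k a, Complex.normSq (U k a) = 1 / d) (R : Matrix ((β × ε) × α) ((β × ε) × α) ℂ)
    (k : α) :
    ∑ e : ε, partialBra β U k e * blockDiagonal (blockDiag R) *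
        (partialBra β U k e)ᴴ =
      ((d⁻¹ : ℝ) : ℂ) • ∑ k, ∑ e : ε, partialBra β U k e * R * (partialBra β U k e)ᴴ := by
  ext b b'
  simp only [Matrix.sum_apply, Matrix.smul_apply, partialBra_mul_mul_apply]
  have hL : ∀ e : ε, ∑ a, ∑ a', U k a * blockDiagonal (blockDiag R) ((b, e), a) ((b', e), a') *
      (starRingEnd ℂ) (U k a') = ∑ a, ((d⁻¹ : ℝ) : ℂ) * R ((b, e), a) ((b', e), a) := by
    intro e
    refine Finset.sum_congr rfl fun a _ => ?_
    rw [Finset.sum_eq_single a (fun a' _ h => by simp [blockDiagonal_apply, h.symm]) (by simp)]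
    rw [blockDiagonal_apply, if_pos rfl, blockDiag_apply, mul_right_comm, Complex.mul_conj, hd,
      one_div]
  have hRt : ∑ k, ∑ e : ε, ∑ a, ∑ a', U k a * R ((b, e), a) ((b', e), a') *
      (starRingEnd ℂ) (U k a') = ∑ e : ε, ∑ a, R ((b, e), a) ((b', e), a) := by
    rw [Finset.sum_comm]
    refine Finset.sum_congr rfl fun e _ => ?_
    rw [Finset.sum_comm]
    refine Finset.sum_congr rfl fun a _ => ?_
    rw [Finset.sum_comm]
    have h : ∀ a', ∑ k, U k a * R ((b, e), a) ((b', e), a') * (starRingEnd ℂ) (U k a') =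
        if a' = a then R ((b, e), a) ((b', e), a) else 0 := by
      intro a'
      have h2 := congrFun (congrFun hU a') a
      simp only [mul_apply, conjTranspose_apply, one_apply] at h2
      calc _ = (∑ k, star (U k a') * U k a) * R ((b, e), a) ((b', e), a') := by
            rw [Finset.sum_mul]
            refine Finset.sum_congr rfl fun k _ => ?_
            rw [starRingEnd_apply]
            ring
        _ = _ := by
            rw [h2]
            split_ifs with h3
            · rw [h3, one_mul]
            · rw [zero_mul]
    simp only [h, Finset.sum_ite_eq', Finset.mem_univ, if_true]
  rw [hRt]
  simp only [hL, Finset.mul_sum, smul_eq_mul]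

lemma Diagonalizes.conjTranspose_mul_mul {n : Type*} [Fintype n] [DecidableEq n]
    {V A : Matrix n n ℂ} {l : n → ℝ} (h : Diagonalizes V l A) :
    Vᴴ * A * V = diagonal (fun i => (l i : ℂ)) := by
  rw [h.eq_mul]
  calc Vᴴ * (V * diagonal (fun i => (l i : ℂ)) * Vᴴ) * V
      = (Vᴴ * V) * diagonal (fun i => (l i : ℂ)) * (Vᴴ * V) := by simp only [Matrix.mul_assoc]
    _ = _ := by rw [h.isometry, Matrix.one_mul, Matrix.mul_one]

lemma Diagonalizes.blockDiagonal {n : Type*} [Fintype n] [DecidableEq n]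
    {V A : α → Matrix n n ℂ} {l : α → n → ℝ} (h : ∀ a, Diagonalizes (V a) (l a) (A a)) :
    Diagonalizes (blockDiagonal V) (fun x => l x.2 x.1) (blockDiagonal A) where
  isometry := by
    rw [blockDiagonal_conjTranspose, ← blockDiagonal_mul, ← blockDiagonal_one]
    congr 1
    funext a
    exact (h a).isometry
  eq_mul := by
    rw [blockDiagonal_conjTranspose, ← blockDiagonal_diagonal (fun a i => (l a i : ℂ)),
      ← blockDiagonal_mul, ← blockDiagonal_mul]
    congr 1
    funext a
    exact (h a).eq_mul

lemma blockDiagonal_conj_apply {n : Type*} [Fintype n] [DecidableEq n]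
    (V : α → Matrix n n ℂ) (R : Matrix (n × α) (n × α) ℂ) (i : n) (a : α) :
    ((blockDiagonal V)ᴴ * R * blockDiagonal V) (i, a) (i, a) =
      ((V a)ᴴ * blockDiag R a * V a) i i := by
  simp only [mul_apply, conjTranspose_apply, blockDiagonal_apply, Fintype.sum_prod_type,
    blockDiag_apply, apply_ite star, star_zero, ite_mul, mul_ite, zero_mul, mul_zero,
    Finset.sum_ite_eq', Finset.mem_univ, if_true]

/-- Uncertainty relation for a state `R` on `β ⊗ ε ⊗ α`: the entropy produced by dephasing in
the standard basis of `α` is bounded below through a measurement in a mutually unbiased basis. -/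
theorem log_le_sum_vNEntropy {d : ℝ} (hd0 : 0 < d) (hU : Uᴴ * U = 1)
    (hd : ∀ k a, Complex.normSq (U k a) = 1 / d) {R : Matrix ((β × ε) × α) ((β × ε) × α) ℂ}
    (hR : R.PosSemidef) (hR1 : R.trace = 1) {ρ : Matrix β β ℂ} {σ : α → Matrix β β ℂ}
    (hσ : ∀ k, σ k = ∑ e : ε, partialBra β U k e * R * (partialBra β U k e)ᴴ)
    (hρ : ρ = ∑ k, σ k) :
    Real.log d ≤ (∑ a, vNEntropy (blockDiag R a) - vNEntropy R) +
      (∑ k, vNEntropy (σ k) - vNEntropy ρ) := by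
  have hτ : ∀ a, (blockDiag R a).PosSemidef := fun a => hR.submatrix fun i => (i, a)
  have hσpos : ∀ k, (σ k).PosSemidef := fun k => by
    rw [hσ k]
    exact posSemidef_sum _ fun e _ => hR.mul_mul_conjTranspose_same _
  have hρpos : ρ.PosSemidef := by
    rw [hρ]
    exact posSemidef_sum _ fun k _ => hσpos k
  obtain ⟨V, l, hl, hdR⟩ := hR.exists_diagonalizes
  obtain ⟨W, m, hm, hdρ⟩ := hρpos.exists_diagonalizes
  choose Vτ μ hμ hdτ using fun a => (hτ a).exists_diagonalizes
  choose Vσ lσ hlσ hdσ using fun k => (hσpos k).exists_diagonalizes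
  have hdT := Diagonalizes.blockDiagonal hdτ
  have hdρ' := hdρ.smul d⁻¹
  have hdiag : ∀ x : (β × ε) × α,
      (((blockDiagonal Vτ)ᴴ * R * blockDiagonal Vτ) x x).re = μ x.2 x.1 := by
    rintro ⟨i, a⟩
    rw [blockDiagonal_conj_apply, (hdτ a).conjTranspose_mul_mul, diagonal_apply_eq,
      Complex.ofReal_re]
  have hsum : ∀ j, ∑ k, ((Wᴴ * σ k * W) j j).re = m j := by
    intro j
    rw [← Complex.re_sum, ← Matrix.sum_apply, ← Matrix.sum_mul, ← Matrix.mul_sum, ← hρ,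
      hdρ.conjTranspose_mul_mul, diagonal_apply_eq, Complex.ofReal_re]
  have hnn : ∀ k j, 0 ≤ ((Wᴴ * σ k * W) j j).re := by
    intro k j
    rw [re_conj_diag (hdσ k)]
    exact Finset.sum_nonneg fun i _ => mul_nonneg (Complex.normSq_nonneg _) (hlσ k i)
  have hσT : ∀ k, Diagonalizes W (fun i => d⁻¹ * m i)
      (∑ e : ε, partialBra β U k e * blockDiagonal (blockDiag R) * (partialBra β U k e)ᴴ) := by
    intro k
    rw [sum_partialBra_mul_blockDiagonal hU hd]
    simp only [← hσ, ← hρ]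
    exact hdρ'
  have hm1 : ∑ j, m j = 1 := by
    rw [← hdρ.trace_re, hρ]
    calc (∑ k, σ k).trace.re
        = ((∑ k, ∑ e : ε, (partialBra β U k e)ᴴ * partialBra β U k e) * R).trace.re := by
          simp only [hσ, Matrix.sum_mul, trace_sum, Complex.re_sum]
          refine Finset.sum_congr rfl fun k _ => Finset.sum_congr rfl fun e _ => ?_
          rw [trace_mul_comm, Matrix.mul_assoc]
      _ = 1 := by rw [sum_conjTranspose_partialBra_mul hU, Matrix.one_mul, hR1, Complex.one_re]
  have key := sum_spectralRelEntropy_le (partialBra_mul_conjTranspose (mul_eq_one_comm.1 hU))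
    (sum_conjTranspose_partialBra_mul hU) hdR hdT hl (fun x => hμ _ _)
    (fun x hx => by rw [hdiag, hx]) (V' := Vσ) (W' := fun _ => W) (l' := lσ)
    (μ' := fun _ i => d⁻¹ * m i) (fun k => by rw [← hσ]; exact hdσ k) hσT hlσ
    (fun _ i => mul_nonneg (inv_nonneg.2 hd0.le) (hm i)) (fun k j hj => by
      rw [← hσ]
      have hj0 : m j = 0 := (mul_eq_zero.1 hj).resolve_left (inv_ne_zero hd0.ne')
      exact (Finset.sum_eq_zero_iff_of_nonneg fun k _ => hnn k j).1
        ((hsum j).trans hj0) k (Finset.mem_univ k))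
  have hsmall : ∀ k, spectralRelEntropy (Vσ k) (lσ k) W (fun i => d⁻¹ * m i) =
      -vNEntropy (σ k) - ∑ j, ((Wᴴ * σ k * W) j j).re * Real.log (d⁻¹ * m j) :=
    fun k => spectralRelEntropy_eq (hdσ k) hdρ'
  have hbig : spectralRelEntropy V l (blockDiagonal Vτ) (fun x => μ x.2 x.1) =
      -vNEntropy R + ∑ a, vNEntropy (blockDiag R a) := by
    rw [spectralRelEntropy_eq hdR hdT]
    simp only [hdiag, (hdτ _).vNEntropy_eq, Fintype.sum_prod_type_right (α₁ := β × ε),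
      Real.negMulLog, neg_mul, Finset.sum_neg_distrib]
    ring
  have hlog : ∑ k, ∑ j, ((Wᴴ * σ k * W) j j).re * Real.log (d⁻¹ * m j) =
      -vNEntropy ρ - Real.log d := by
    rw [Finset.sum_comm]
    simp only [← Finset.sum_mul, hsum]
    have : ∀ j, m j * Real.log (d⁻¹ * m j) = -Real.negMulLog (m j) - m j * Real.log d := by
      intro j
      rcases (hm j).eq_or_lt with h | h
      · simp [← h]
      · rw [Real.log_mul (inv_ne_zero hd0.ne') h.ne', Real.log_inv, Real.negMulLog]
        ring
    simp only [this, Finset.sum_sub_distrib, Finset.sum_neg_distrib, ← Finset.sum_mul, hm1,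
      one_mul, hdρ.vNEntropy_eq]
  simp only [hsmall, Finset.sum_sub_distrib, Finset.sum_neg_distrib] at key
  rw [hlog, hbig] at key
  linarith

end UncertaintyRelation

section OrthonormalBases

open Matrix

lemma Finset.sum_comm_pairs {α β γ : Type*} [Fintype α] [Fintype β] [Fintype γ]
    (f : α → α → β → γ → ℂ) :
    ∑ a, ∑ a', ∑ b, ∑ e, f a a' b e = ∑ b, ∑ e, ∑ a, ∑ a', f a a' b e := by
  have h := Finset.sum_comm (s := Finset.univ) (t := Finset.univ)
    (f := fun (p : α × α) (q : β × γ) => f p.1 p.2 q.1 q.2)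
  simpa only [Fintype.sum_prod_type] using h

lemma sum_conj_mul_mul_conj_sum {α : Type*} [Fintype α] (u x y : α → ℂ) :
    (∑ a, (starRingEnd ℂ) (u a) * x a) * (starRingEnd ℂ) (∑ a, (starRingEnd ℂ) (u a) * y a) =
      ∑ a, ∑ a', u a * (starRingEnd ℂ) (u a') * (x a' * (starRingEnd ℂ) (y a)) := by
  rw [map_sum, Finset.sum_mul_sum, Finset.sum_comm]
  refine Finset.sum_congr rfl fun a _ => Finset.sum_congr rfl fun a' _ => ?_
  rw [map_mul, Complex.conj_conj]
  ring

variable {α : Type*} [Fintype α] [DecidableEq α]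

lemma OrthonormalBasis.conjTranspose_of_mul (v : OrthonormalBasis α ℂ (EuclideanSpace ℂ α)) :
    (of fun a j => v j a : Matrix α α ℂ)ᴴ * (of fun a j => v j a) = 1 := by
  ext j k
  have h := orthonormal_iff_ite.1 v.orthonormal j k
  rw [PiLp.inner_apply] at h
  simp only [mul_apply, conjTranspose_apply, of_apply, one_apply, ← h]
  refine Finset.sum_congr rfl fun a _ => ?_
  simp [mul_comm]

lemma OrthonormalBasis.sum_mul_conj (v : OrthonormalBasis α ℂ (EuclideanSpace ℂ α)) (a a' : α) :
    ∑ j, v j a * (starRingEnd ℂ) (v j a') = if a = a' then 1 else 0 := by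
  have h0 : (of fun a j => v j a : Matrix α α ℂ) * (of fun a j => v j a)ᴴ = 1 :=
    mul_eq_one_comm.1 v.conjTranspose_of_mul
  have h := congrFun (congrFun h0 a) a'
  simpa [mul_apply, one_apply] using h

/-- Summing the post-measurement blocks over an orthonormal basis gives the partial trace. -/
lemma OrthonormalBasis.sum_sum_mul_conj_mul (v : OrthonormalBasis α ℂ (EuclideanSpace ℂ α))
    (f : α → α → ℂ) :
    ∑ j, ∑ a, ∑ a', v j a * (starRingEnd ℂ) (v j a') * f a' a = ∑ a, f a a := by
  rw [Finset.sum_comm]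
  refine Finset.sum_congr rfl fun a _ => ?_
  rw [Finset.sum_comm]
  simp only [← Finset.sum_mul, v.sum_mul_conj, ite_mul, one_mul, zero_mul, Finset.sum_ite_eq,
    Finset.mem_univ, if_true]

end OrthonormalBases

/-- Uncertainty principle with quantum side information for mutually
unbiased bases: for a density matrix `ρ` on `H_a ⊗ H_b ⊗ H_c` with `dim H_a = d` and
mutually unbiased bases `v, w` of `H_a` (`|⟨v j, w k⟩|² = 1/d`),
`H(v|c) + H(w|b) ≥ log d`, where `H(v|c) = H(v) - χ(v,c)` and
`χ(v,c) = S(ρ_c) - ∑ j, p j * S(ρ_{c,j})`. -/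
theorem upqsi_mub (da db dc : ℕ) (hda : 0 < da)
    (ρ : Matrix (Fin da × Fin db × Fin dc) (Fin da × Fin db × Fin dc) ℂ)
    (hρ : ρ.PosSemidef) (hρ1 : ρ.trace = 1)
    (v w : OrthonormalBasis (Fin da) ℂ (EuclideanSpace ℂ (Fin da)))
    (hmub : ∀ j k, ‖(⟪v j, w k⟫_ℂ : ℂ)‖ ^ 2 = 1 / da)
    (ρb : Matrix (Fin db) (Fin db) ℂ)
    (hρb : ∀ b b', ρb b b' = ∑ a, ∑ c, ρ (a, b, c) (a, b', c))
    (ρc : Matrix (Fin dc) (Fin dc) ℂ)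
    (hρc : ∀ c c', ρc c c' = ∑ a, ∑ b, ρ (a, b, c) (a, b, c'))
    (pv : Fin da → ℝ)
    (hpv : ∀ j, pv j =
      (∑ a, ∑ a', ∑ b, ∑ c, v j a * (starRingEnd ℂ) (v j a') * ρ (a', b, c) (a, b, c)).re)
    (pw : Fin da → ℝ)
    (hpw : ∀ k, pw k =
      (∑ a, ∑ a', ∑ b, ∑ c, w k a * (starRingEnd ℂ) (w k a') * ρ (a', b, c) (a, b, c)).re)
    (σc : Fin da → Matrix (Fin dc) (Fin dc) ℂ)
    (hσc : ∀ j c c', σc j c c' =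
      ∑ a, ∑ a', ∑ b, v j a * (starRingEnd ℂ) (v j a') * ρ (a', b, c) (a, b, c'))
    (σb : Fin da → Matrix (Fin db) (Fin db) ℂ)
    (hσb : ∀ k b b', σb k b b' =
      ∑ a, ∑ a', ∑ c, w k a * (starRingEnd ℂ) (w k a') * ρ (a', b, c) (a, b', c)) :
    ((-∑ j, pv j * Real.log (pv j)) -
        (vNEntropy ρc - ∑ j, pv j * vNEntropy (((pv j : ℂ))⁻¹ • σc j))) +
      ((-∑ k, pw k * Real.log (pw k)) -
        (vNEntropy ρb - ∑ k, pw k * vNEntropy (((pw k : ℂ))⁻¹ • σb k))) ≥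
      Real.log da := by
  classical
  obtain ⟨A, hA⟩ := hρ.exists_eq_mul_conjTranspose
  have hρA : ∀ x y, ρ x y = ∑ e, A x e * (starRingEnd ℂ) (A y e) := by
    intro x y
    rw [hA, Matrix.mul_apply]
    rfl
  set φ : Fin da → Fin db → Fin dc → Fin da × Fin db × Fin dc → ℂ :=
    fun j b c e => ∑ a, (starRingEnd ℂ) (v j a) * A (a, b, c) e with hφ
  set φw : Fin da → Fin db → Fin dc → Fin da × Fin db × Fin dc → ℂ :=
    fun k b c e => ∑ a, (starRingEnd ℂ) (w k a) * A (a, b, c) e with hφw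
  set U : Matrix (Fin da) (Fin da) ℂ :=
    (Matrix.of fun a k => w k a).conjTranspose * Matrix.of fun a j => v j a with hUdef
  have hUapp : ∀ k j, U k j = ∑ a, (starRingEnd ℂ) (w k a) * v j a := by
    intro k j
    simp [hUdef, Matrix.mul_apply]
  have hU : U.conjTranspose * U = 1 := by
    rw [hUdef, Matrix.conjTranspose_mul, Matrix.conjTranspose_conjTranspose, Matrix.mul_assoc,
      ← Matrix.mul_assoc (Matrix.of fun a k => w k a),
      mul_eq_one_comm.1 w.conjTranspose_of_mul, Matrix.one_mul, v.conjTranspose_of_mul]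
  have hUd : ∀ k j, Complex.normSq (U k j) = 1 / da := by
    intro k j
    rw [← hmub j k, Complex.normSq_eq_norm_sq, ← inner_conj_symm, RCLike.norm_conj, hUapp,
      PiLp.inner_apply]
    simp [mul_comm]
  have hφU : ∀ k b c e, ∑ j, U k j * φ j b c e = φw k b c e := by
    intro k b c e
    simp only [hUapp, hφ, Finset.sum_mul_sum]
    rw [Finset.sum_comm]
    refine Finset.sum_congr rfl fun a _ => ?_
    rw [Finset.sum_comm]
    calc _ = ∑ a', (starRingEnd ℂ) (w k a) * (∑ j, v j a * (starRingEnd ℂ) (v j a')) *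
          A (a', b, c) e := by
          refine Finset.sum_congr rfl fun a' _ => ?_
          rw [Finset.mul_sum, Finset.sum_mul]
          exact Finset.sum_congr rfl fun j _ => by ring
      _ = _ := by simp [v.sum_mul_conj]
  set N : Matrix ((Fin db × (Fin da × Fin db × Fin dc)) × Fin da) (Fin dc) ℂ :=
    Matrix.of fun x c => φ x.2 x.1.1 c x.1.2 with hN
  set M : Fin da → Matrix (Fin db × (Fin da × Fin db × Fin dc)) (Fin dc) ℂ :=
    fun j => Matrix.of fun x c => φ j x.1 c x.2 with hM
  have hσcM : ∀ j, σc j = ((M j).conjTranspose * M j).transpose := by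
    intro j
    ext c c'
    rw [hσc, Matrix.transpose_apply, Matrix.mul_apply, Fintype.sum_prod_type]
    have h : ∀ b e, (M j).conjTranspose c' (b, e) * M j (b, e) c = ∑ a, ∑ a',
        v j a * (starRingEnd ℂ) (v j a') *
          (A (a', b, c) e * (starRingEnd ℂ) (A (a, b, c') e)) := by
      intro b e
      rw [mul_comm, ← sum_conj_mul_mul_conj_sum]
      rfl
    simp only [h, hρA, Finset.mul_sum]
    exact Finset.sum_comm_pairs fun a a' b e => v j a * (starRingEnd ℂ) (v j a') *
      (A (a', b, c) e * (starRingEnd ℂ) (A (a, b, c') e))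
  have hσbφ : ∀ k b b', σb k b b' =
      ∑ c, ∑ e, φw k b c e * (starRingEnd ℂ) (φw k b' c e) := by
    intro k b b'
    simp only [hσb, hφw, sum_conj_mul_mul_conj_sum, hρA, Finset.mul_sum]
    exact Finset.sum_comm_pairs fun a a' c e => w k a * (starRingEnd ℂ) (w k a') *
      (A (a', b, c) e * (starRingEnd ℂ) (A (a, b', c) e))
  have hρcN : ρc = (N.conjTranspose * N).transpose := by
    have h : ρc = ∑ j, σc j := by
      ext c c'
      rw [Matrix.sum_apply, hρc]
      simp only [hσc, ← Finset.mul_sum]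
      rw [v.sum_sum_mul_conj_mul fun a' a => ∑ b, ρ (a', b, c) (a, b, c')]
    rw [h]
    ext c c'
    simp only [Matrix.sum_apply, hσcM, Matrix.transpose_apply, Matrix.mul_apply,
      Fintype.sum_prod_type_right (α₂ := Fin da)]
    rfl
  have hρbσ : ρb = ∑ k, σb k := by
    ext b b'
    rw [Matrix.sum_apply, hρb]
    simp only [hσb, ← Finset.mul_sum]
    rw [w.sum_sum_mul_conj_mul fun a' a => ∑ c, ρ (a', b, c) (a, b', c)]
  have hσbU : ∀ k, σb k = ∑ e : Fin da × Fin db × Fin dc,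
      partialBra (Fin db) U k e * (N * N.conjTranspose) *
      (partialBra (Fin db) U k e).conjTranspose := by
    intro k
    ext b b'
    rw [hσbφ, Matrix.sum_apply, Finset.sum_comm]
    refine Finset.sum_congr rfl fun e _ => ?_
    rw [partialBra_mul_mul_apply]
    have h : ∀ j j', U k j * (N * N.conjTranspose) ((b, e), j) ((b', e), j') *
        (starRingEnd ℂ) (U k j') = ∑ c, (U k j * φ j b c e) *
          (starRingEnd ℂ) (U k j' * φ j' b' c e) := by
      intro j j'
      rw [Matrix.mul_apply, Finset.mul_sum, Finset.sum_mul]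
      refine Finset.sum_congr rfl fun c _ => ?_
      rw [map_mul]
      simp only [hN, Matrix.of_apply, Matrix.conjTranspose_apply, starRingEnd_apply]
      ring
    simp only [h, ← hφU, map_sum, Finset.sum_mul_sum]
    rw [Finset.sum_comm]
    refine Finset.sum_congr rfl fun j _ => ?_
    rw [Finset.sum_comm]
  have htr : (N * N.conjTranspose).trace = 1 := by
    rw [Matrix.trace_mul_comm, ← Matrix.trace_transpose, ← hρcN, ← hρ1]
    simp only [Matrix.trace, Matrix.diag_apply, hρc, Fintype.sum_prod_type]
    rw [Finset.sum_comm]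
    refine Finset.sum_congr rfl fun a _ => ?_
    rw [Finset.sum_comm]
  have hσcpos : ∀ j, (σc j).PosSemidef := fun j => by
    rw [hσcM]
    exact (Matrix.posSemidef_conjTranspose_mul_self _).transpose
  have hσbpos : ∀ k, (σb k).PosSemidef := fun k => by
    rw [hσbU]
    exact Matrix.posSemidef_sum _ fun e _ =>
      (Matrix.posSemidef_self_mul_conjTranspose N).mul_mul_conjTranspose_same _
  have hpvt : ∀ j, pv j = (σc j).trace.re := by
    intro j
    rw [hpv]
    congr 1
    simp only [Matrix.trace, Matrix.diag_apply, hσc]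
    symm
    rw [Finset.sum_comm]
    refine Finset.sum_congr rfl fun a _ => ?_
    rw [Finset.sum_comm]
    refine Finset.sum_congr rfl fun a' _ => ?_
    rw [Finset.sum_comm]
  have hpwt : ∀ k, pw k = (σb k).trace.re := by
    intro k
    rw [hpw]
    congr 1
    simp only [Matrix.trace, Matrix.diag_apply, hσb]
    symm
    rw [Finset.sum_comm]
    refine Finset.sum_congr rfl fun a _ => ?_
    rw [Finset.sum_comm]
  have key := log_le_sum_vNEntropy (d := (da : ℝ)) (by exact_mod_cast hda) hU hUd
    (Matrix.posSemidef_self_mul_conjTranspose N) htr hσbU hρbσ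
  have hSc : ∀ j, vNEntropy (Matrix.blockDiag (N * N.conjTranspose) j) = vNEntropy (σc j) := by
    intro j
    rw [hσcM, vNEntropy_transpose (Matrix.isHermitian_conjTranspose_mul_self _),
      ← vNEntropy_mul_conjTranspose]
    rfl
  have hSρc : vNEntropy (N * N.conjTranspose) = vNEntropy ρc := by
    rw [hρcN, vNEntropy_transpose (Matrix.isHermitian_conjTranspose_mul_self _),
      vNEntropy_mul_conjTranspose]
  have hc := fun j => negMulLog_trace_add_vNEntropy (hσcpos j) (hpvt j)
  have hb := fun k => negMulLog_trace_add_vNEntropy (hσbpos k) (hpwt k)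
  simp only [hSc, hSρc, ← hc, ← hb, Finset.sum_add_distrib, Real.negMulLog, neg_mul,
    Finset.sum_neg_distrib] at key
  linarith
end
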